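/- arXiv:2009.01292 — 5 statements merged into one kernel-verified Lean document; each statement's English description precedes it below -/
import Mathlib

section
/- Let u ∈ ℝ be irrational, let a ≥ 2 be an integer, and let v ∈ ℝ be arbitrary. Then the closure in the circle 𝕋 = ℝ/ℤ of the set {(n·u + a^n·v) mod 1 : n ∈ ℕ (including n = 0)} has Hausdorff dimension 1. -/
open MeasureTheory Set

namespace RotationPower

/-- The word of length `K` read in the sequence `d` from position `n` on. -/
def word {α : Type*} (d : ℕ → α) (K n : ℕ) : Fin K → α := fun i => d (n + i)

/-- The number of words of length `K` read from the positions in `S`. -/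
noncomputable def wordCount {α : Type*} (d : ℕ → α) (K : ℕ) (S : Set ℕ) : ℕ :=
  (word d K '' S).ncard

/-- The positions that follow an occurrence of the letter `b` at a position in `S`. -/
def child {α : Type*} (d : ℕ → α) (b : α) (S : Set ℕ) : Set ℕ :=
  {n | ∃ m ∈ S, d m = b ∧ n = m + 1}

/-- `Rich d D J m S q`: the tree of words of length `m` read from the positions in `S` can be
pruned so that every node either has more than `D` children, or is paid for by `J` units of a
budget which starts at `q` and gains one unit at each node with more than `D` children. -/
def Rich {α : Type*} (d : ℕ → α) (D : ℝ) (J : ℕ) : ℕ → Set ℕ → ℕ → Prop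
  | 0, S, _ => S.Nonempty
  | m + 1, S, q => D < ({b | Rich d D J m (child d b S) (q + 1)} : Set α).ncard ∨
      (J ≤ q ∧ ∃ b, Rich d D J m (child d b S) (q - J))

section Counting

variable {α : Type*} {d : ℕ → α}

lemma child_mono {S T : Set ℕ} (h : S ⊆ T) (b : α) : child d b S ⊆ child d b T := by
  rintro n ⟨m, hm, h1, h2⟩
  exact ⟨m, h hm, h1, h2⟩

lemma wordCount_mono [Finite α] {S T : Set ℕ} (h : S ⊆ T) (K : ℕ) :
    wordCount d K S ≤ wordCount d K T :=
  ncard_le_ncard (image_mono h) (toFinite _)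

lemma wordCount_zero_le (S : Set ℕ) : wordCount d 0 S ≤ 1 :=
  ncard_le_one_of_subsingleton _

lemma wordCount_empty (K : ℕ) : wordCount d K ∅ = 0 := by
  simp [wordCount]

lemma wordCount_biUnion_le {ι : Type*} (F : Finset ι) (S : ι → Set ℕ) (K : ℕ) :
    wordCount d K (⋃ i ∈ F, S i) ≤ ∑ i ∈ F, wordCount d K (S i) := by
  unfold wordCount
  rw [image_iUnion₂]
  exact Finset.set_ncard_biUnion_le F _

lemma wordCount_succ_le [Fintype α] (K : ℕ) (S : Set ℕ) :
    wordCount d (K + 1) S ≤ ∑ b, wordCount d K (child d b S) := by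
  have hsub : word d (K + 1) '' S ⊆
      ⋃ b ∈ (Finset.univ : Finset α),
        (fun w => (Fin.cons b w : Fin (K + 1) → α)) '' (word d K '' child d b S) := by
    rintro _ ⟨n, hn, rfl⟩
    simp only [Finset.mem_univ, iUnion_true, mem_iUnion]
    refine ⟨d n, _, ⟨n + 1, ⟨n, hn, rfl, rfl⟩, rfl⟩, ?_⟩
    funext i
    refine Fin.cases ?_ (fun i => ?_) i
    · simp [word]
    · simp [word, add_assoc, add_comm 1]
  refine (ncard_le_ncard hsub (toFinite _)).trans ((Finset.set_ncard_biUnion_le _ _).trans ?_)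
  exact Finset.sum_le_sum fun b _ => ncard_image_le (toFinite _)

/-- The words read from a node that is not rich are fewer, by the factor `ν ^ q`, than what the
bound `P` for whole tubes would give. -/
lemma wordCount_le_of_not_rich [Fintype α] {D γ ν : ℝ} {J : ℕ} (hν0 : 0 < ν) (hν1 : ν ≤ 1)
    (hD : 0 ≤ D)
    (hcond : γ * (D + Fintype.card α * ν ^ (J + 1)) ≤ ν ^ J)
    {tube : ℕ → Set ℕ} (htube : ∀ n b, child d b (tube n) ⊆ tube (n + 1))
    {P : ℕ → ℕ → ℝ} (hP0 : ∀ n K, 0 ≤ P n K)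
    (hP : ∀ n K, P (n + 1) K ≤ γ * P n (K + 1)) {M : ℕ}
    (hbase : ∀ n, 1 ≤ ν ^ M * P n 0) {K₀ : ℕ}
    (hK₀ : ∀ K ≤ K₀, ∀ n, (wordCount d K (tube n) : ℝ) ≤ P n K) :
    ∀ m q n K (S : Set ℕ), K ≤ K₀ + 1 → q + m ≤ M → S ⊆ tube n → ¬ Rich d D J m S q →
      (wordCount d K S : ℝ) ≤ ν ^ q * P n K := by
  intro m
  induction m with
  | zero =>
    intro q n K S _ _ _ h
    have : S = ∅ := not_nonempty_iff_eq_empty.mp h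
    subst this
    rw [wordCount_empty]
    have := hP0 n K
    push_cast
    positivity
  | succ m ih =>
    intro q n K S hK hq hS h
    rcases K with _ | K
    · have h1 : (wordCount d 0 S : ℝ) ≤ 1 := by exact_mod_cast wordCount_zero_le S
      refine h1.trans ((hbase n).trans ?_)
      exact mul_le_mul_of_nonneg_right (pow_le_pow_of_le_one hν0.le hν1 (by omega)) (hP0 _ _)
    classical
    simp only [Rich, not_or, not_lt, not_and, not_exists] at h
    obtain ⟨h1, h2⟩ := h
    have hKK : K ≤ K₀ := by omega
    have hch : ∀ b, child d b S ⊆ tube (n + 1) := fun b => (child_mono hS b).trans (htube n b)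
    set p := P (n + 1) K with hp
    have hp0 : 0 ≤ p := hP0 _ _
    have hbound : ∀ b, (wordCount d K (child d b S) : ℝ) ≤
        (if Rich d D J m (child d b S) (q + 1) then ν ^ q / ν ^ J * p else 0) +
          ν ^ (q + 1) * p := by
      intro b
      split_ifs with hb
      · have hle : (wordCount d K (child d b S) : ℝ) ≤ ν ^ q / ν ^ J * p := by
          by_cases hJ : J ≤ q
          · have := ih (q - J) (n + 1) K _ (by omega) (by omega) (hch b) (h2 hJ b)
            rwa [pow_sub₀ _ hν0.ne' hJ, ← div_eq_mul_inv] at this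
          · refine ((Nat.cast_le.mpr (wordCount_mono (hch b) K)).trans (hK₀ K hKK (n + 1))).trans ?_
            refine le_mul_of_one_le_left hp0 ?_
            rw [one_le_div (by positivity)]
            exact pow_le_pow_of_le_one hν0.le hν1 (by omega)
        have : 0 ≤ ν ^ (q + 1) * p := by positivity
        linarith
      · rw [zero_add]
        exact ih (q + 1) (n + 1) K _ (by omega) (by omega) (hch b) hb
    have hcard : (({b | Rich d D J m (child d b S) (q + 1)} : Set α).ncard : ℝ) =
        ((Finset.univ.filter fun b => Rich d D J m (child d b S) (q + 1)).card : ℝ) := by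
      rw [← ncard_coe_finset]
      simp
    calc (wordCount d (K + 1) S : ℝ) ≤ ∑ b, (wordCount d K (child d b S) : ℝ) := by
          exact_mod_cast wordCount_succ_le (d := d) K S
      _ ≤ ∑ b, ((if Rich d D J m (child d b S) (q + 1) then ν ^ q / ν ^ J * p else 0) +
          ν ^ (q + 1) * p) := Finset.sum_le_sum fun b _ => hbound b
      _ = ({b | Rich d D J m (child d b S) (q + 1)} : Set α).ncard * (ν ^ q / ν ^ J * p) +
          Fintype.card α * (ν ^ (q + 1) * p) := by
          rw [Finset.sum_add_distrib, ← Finset.sum_filter, Finset.sum_const, hcard]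
          simp
      _ ≤ D * (ν ^ q / ν ^ J * p) + Fintype.card α * (ν ^ (q + 1) * p) := by gcongr
      _ = ν ^ q / ν ^ J * (D + Fintype.card α * ν ^ (J + 1)) * p := by
          field_simp
          ring
      _ ≤ ν ^ q / ν ^ J * (D + Fintype.card α * ν ^ (J + 1)) * (γ * P n (K + 1)) := by
          gcongr
          exact hP n K
      _ = ν ^ q / ν ^ J * P n (K + 1) * (γ * (D + Fintype.card α * ν ^ (J + 1))) := by ring
      _ ≤ ν ^ q / ν ^ J * P n (K + 1) * ν ^ J := by
          have := hP0 n (K + 1)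
          gcongr
      _ = ν ^ q * P n (K + 1) := by field_simp

/-- If the number of words grows almost like a power of the number of letters, then at least half
of the positions in some window of any large length are rich. -/
lemma exists_window_rich [Fintype α] [Nonempty α] {c e : ℝ} (hc : 0 < c) (he : 1 ≤ e)
    (hgrowth : ∀ K, c * (Fintype.card α / e) ^ K ≤ wordCount d K univ)
    {tube : ℕ → Set ℕ} (htube : ∀ n b, child d b (tube n) ⊆ tube (n + 1))
    {F : Finset ℕ} (hF : univ ⊆ ⋃ n ∈ F, tube n) (J M : ℕ) :
    ∃ K₁, ∀ K ≥ K₁, ∃ n₀, ∃ E ⊆ Finset.Ico n₀ (n₀ + K), K < 2 * E.card ∧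
      ∀ n ∈ E, Rich d (Fintype.card α * (1 / (4 * e ^ 2)) ^ (J + 1)) J M (tube n) 0 := by
  classical
  set B : ℝ := (Fintype.card α : ℝ) with hB
  have hB0 : 0 < B := by
    rw [hB]
    exact_mod_cast Fintype.card_pos
  set ν : ℝ := 1 / (4 * e ^ 2) with hν
  have he0 : 0 < e := by linarith
  have hν0 : 0 < ν := by positivity
  have hν1 : ν ≤ 1 / 4 := by
    rw [hν, div_le_div_iff₀ (by positivity) (by norm_num)]
    nlinarith
  set γ : ℝ := 1 / (2 * B * ν) with hγ
  have hγ0 : 0 < γ := by positivity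
  set V : ℝ := B * γ with hV
  have hV2 : V = 1 / (2 * ν) := by
    rw [hV, hγ]
    field_simp
  have hV1 : 1 ≤ V := by
    rw [hV2, le_div_iff₀ (by positivity)]
    linarith
  set D : ℝ := B * ν ^ (J + 1) with hD
  set G : Set ℕ := {n | Rich d D J M (tube n) 0} with hG
  set W : ℕ → ℕ → Finset ℕ := fun n K => (Finset.Ico n (n + K)).filter (· ∈ G) with hW
  set P : ℕ → ℕ → ℝ := fun n K => (ν ^ M)⁻¹ * (γ ^ K)⁻¹ * V ^ (W n K).card with hPdef
  have hP0 : ∀ n K, 0 ≤ P n K := fun n K => by positivity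
  have hWsub : ∀ n K, W (n + 1) K ⊆ W n (K + 1) := fun n K => by
    intro x hx
    simp only [hW, Finset.mem_filter, Finset.mem_Ico] at hx ⊢
    exact ⟨⟨by omega, by omega⟩, hx.2⟩
  have hPle : ∀ n K, P (n + 1) K ≤ γ * P n (K + 1) := fun n K => by
    have h1 : V ^ (W (n + 1) K).card ≤ V ^ (W n (K + 1)).card :=
      pow_le_pow_right₀ hV1 (Finset.card_le_card (hWsub n K))
    have h2 : γ * P n (K + 1) = (ν ^ M)⁻¹ * (γ ^ K)⁻¹ * V ^ (W n (K + 1)).card := by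
      simp only [hPdef, pow_succ]
      field_simp
    rw [h2]
    exact mul_le_mul_of_nonneg_left h1 (by positivity)
  have hbase : ∀ n, 1 ≤ ν ^ M * P n 0 := fun n => by
    have h1 : (1 : ℝ) ≤ V ^ (W n 0).card := one_le_pow₀ hV1
    have h2 : ν ^ M * P n 0 = V ^ (W n 0).card := by
      simp only [hPdef]
      field_simp
    rwa [h2]
  have hcond : γ * (D + B * ν ^ (J + 1)) ≤ ν ^ J := by
    rw [hD, hγ, pow_succ]
    apply le_of_eq
    field_simp
    ring
  have main : ∀ K₀, ∀ K ≤ K₀, ∀ n, (wordCount d K (tube n) : ℝ) ≤ P n K := by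
    intro K₀
    induction K₀ with
    | zero =>
      intro K hK n
      obtain rfl : K = 0 := by omega
      have h1 : (wordCount d 0 (tube n) : ℝ) ≤ 1 := by exact_mod_cast wordCount_zero_le (tube n)
      refine h1.trans ((hbase n).trans ?_)
      exact mul_le_of_le_one_left (hP0 _ _) (pow_le_one₀ hν0.le (by linarith))
    | succ K₀ ih =>
      intro K hK n
      by_cases hn : n ∈ G
      · rcases K with _ | K
        · exact ih 0 (by omega) n
        have hins : W n (K + 1) = insert n (W (n + 1) K) := by
          ext x
          simp only [hW, Finset.mem_filter, Finset.mem_Ico, Finset.mem_insert]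
          constructor
          · rintro ⟨⟨h1, h2⟩, h3⟩
            by_cases hx : x = n
            · exact Or.inl hx
            · exact Or.inr ⟨⟨by omega, by omega⟩, h3⟩
          · rintro (rfl | ⟨⟨h1, h2⟩, h3⟩)
            · exact ⟨⟨le_rfl, by omega⟩, hn⟩
            · exact ⟨⟨by omega, by omega⟩, h3⟩
        have hnot : n ∉ W (n + 1) K := by simp [hW]
        have hcardW : (W n (K + 1)).card = (W (n + 1) K).card + 1 := by
          rw [hins, Finset.card_insert_of_notMem hnot]
        calc (wordCount d (K + 1) (tube n) : ℝ)
            ≤ ∑ b, (wordCount d K (child d b (tube n)) : ℝ) := by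
              exact_mod_cast wordCount_succ_le (d := d) K (tube n)
          _ ≤ ∑ _b : α, P (n + 1) K := by
              refine Finset.sum_le_sum fun b _ => ?_
              refine le_trans ?_ (ih K (by omega) (n + 1))
              exact_mod_cast wordCount_mono (htube n b) K
          _ = B * P (n + 1) K := by simp [hB]
          _ = P n (K + 1) := by
              simp only [hPdef, hcardW, pow_succ, hV]
              field_simp
      · have := wordCount_le_of_not_rich hν0 (by linarith) (by positivity) hcond htube hP0 hPle
          hbase ih M 0 n K (tube n) hK (by omega) subset_rfl hn
        simpa using this
  set R : ℝ := F.card * (ν ^ M)⁻¹ with hR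
  obtain ⟨K₁, hK₁⟩ := exists_pow_lt_of_lt_one (show 0 < c ^ 2 / (R ^ 2 + 1) by positivity)
    (show (1 / 2 : ℝ) < 1 by norm_num)
  refine ⟨K₁, fun K hK => ?_⟩
  by_contra hcon
  push Not at hcon
  have hcnt : ∀ n, 2 * (W n K).card ≤ K := fun n => by
    by_contra h
    obtain ⟨x, hx, hx2⟩ := hcon n (W n K) (Finset.filter_subset _ _) (by omega)
    exact hx2 (Finset.mem_filter.mp hx).2
  have hPK : ∀ n, P n K ≤ (ν ^ M)⁻¹ * (γ ^ K)⁻¹ * V ^ (K / 2) := fun n => by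
    have h1 : V ^ (W n K).card ≤ V ^ (K / 2) :=
      pow_le_pow_right₀ hV1 (by have := hcnt n; omega)
    exact mul_le_mul_of_nonneg_left h1 (by positivity)
  have hsum : c * (B / e) ^ K ≤ R * ((γ ^ K)⁻¹ * V ^ (K / 2)) := by
    calc c * (B / e) ^ K ≤ wordCount d K univ := hgrowth K
      _ ≤ ∑ n ∈ F, (wordCount d K (tube n) : ℝ) := by
          exact_mod_cast (wordCount_mono hF K).trans (wordCount_biUnion_le F tube K)
      _ ≤ ∑ n ∈ F, (ν ^ M)⁻¹ * (γ ^ K)⁻¹ * V ^ (K / 2) :=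
          Finset.sum_le_sum fun n _ => (main K K le_rfl n).trans (hPK n)
      _ = R * ((γ ^ K)⁻¹ * V ^ (K / 2)) := by
          rw [Finset.sum_const, nsmul_eq_mul, hR]
          ring
  have hsq : (c * (B / e) ^ K) ^ 2 ≤ R ^ 2 * (1 / 2) ^ K * ((B / e) ^ K) ^ 2 := by
    calc (c * (B / e) ^ K) ^ 2 ≤ (R * ((γ ^ K)⁻¹ * V ^ (K / 2))) ^ 2 := by
          gcongr
      _ = R ^ 2 * ((γ ^ K)⁻¹ ^ 2 * V ^ (2 * (K / 2))) := by
          rw [pow_mul' V 2 (K / 2)]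
          ring
      _ ≤ R ^ 2 * ((γ ^ K)⁻¹ ^ 2 * V ^ K) := by
          gcongr
          exact Nat.mul_div_le K 2
      _ = R ^ 2 * ((γ⁻¹ ^ 2 * V) ^ K) := by
          rw [mul_pow (γ⁻¹ ^ 2) V K, ← inv_pow γ K, pow_right_comm]
      _ = R ^ 2 * ((1 / 2) * (B / e) ^ 2) ^ K := by
          congr 2
          rw [hV2, hγ, hν]
          field_simp
          ring
      _ = R ^ 2 * (1 / 2) ^ K * ((B / e) ^ K) ^ 2 := by
          rw [mul_pow (1 / 2) ((B / e) ^ 2) K, pow_right_comm]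
          ring
  have hpos : 0 < ((B / e) ^ K) ^ 2 := by positivity
  rw [mul_pow] at hsq
  have h1 := le_of_mul_le_mul_right hsq hpos
  have h2 : ((1 : ℝ) / 2) ^ K ≤ (1 / 2) ^ K₁ :=
    pow_le_pow_of_le_one (by norm_num) (by norm_num) hK
  rw [lt_div_iff₀ (by positivity)] at hK₁
  have h3 : (0 : ℝ) < (1 / 2) ^ K₁ := by positivity
  nlinarith [mul_le_mul_of_nonneg_left h2 (sq_nonneg R)]

end Counting
section Selection

/-- A greedy choice of `r` letters meets most of the sets `G i`, if all of them are large. -/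
lemma exists_hitting_set {α ι : Type*} [Fintype α] [Nonempty α] [DecidableEq α] (E : Finset ι)
    (G : ι → Finset α)
    {ψ : ι → ℝ} (hψ : ∀ i ∈ E, 0 ≤ ψ i) {θ : ℝ} (hθ1 : θ ≤ 1)
    (hG : ∀ i ∈ E, Fintype.card α * θ ≤ (G i).card) (r : ℕ) :
    ∃ A : Finset α, A.card ≤ r ∧
      ∑ i ∈ E with Disjoint (G i) A, ψ i ≤ (1 - θ) ^ r * ∑ i ∈ E, ψ i := by
  induction r with
  | zero => exact ⟨∅, by simp, by simp⟩
  | succ r ih =>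
    obtain ⟨A, hA, hsum⟩ := ih
    set U := E.filter fun i => Disjoint (G i) A with hU
    have hUE : U ⊆ E := Finset.filter_subset _ _
    have hB0 : (0 : ℝ) < Fintype.card α := by exact_mod_cast Fintype.card_pos
    obtain ⟨b, -, hb⟩ : ∃ b ∈ (Finset.univ : Finset α),
        θ * ∑ i ∈ U, ψ i ≤ ∑ i ∈ U with b ∈ G i, ψ i := by
      refine Finset.exists_le_of_sum_le Finset.univ_nonempty ?_
      have h1 : ∑ b, ∑ i ∈ U with b ∈ G i, ψ i = ∑ i ∈ U, (G i).card * ψ i := by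
        simp_rw [Finset.sum_filter]
        rw [Finset.sum_comm]
        refine Finset.sum_congr rfl fun i _ => ?_
        rw [← Finset.sum_filter]
        simp
      rw [h1, Finset.sum_const, nsmul_eq_mul, Finset.card_univ, ← mul_assoc, Finset.mul_sum]
      exact Finset.sum_le_sum fun i hi => mul_le_mul_of_nonneg_right (hG i (hUE hi)) (hψ i (hUE hi))
    refine ⟨insert b A, (Finset.card_insert_le _ _).trans (by omega), ?_⟩
    have h2 : (E.filter fun i => Disjoint (G i) (insert b A)) = U.filter fun i => ¬ b ∈ G i := by
      ext i
      simp only [hU, Finset.mem_filter, Finset.disjoint_insert_right]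
      tauto
    have h3 := Finset.sum_filter_add_sum_filter_not U (fun i => b ∈ G i) ψ
    rw [h2, pow_succ]
    calc ∑ i ∈ U with ¬ b ∈ G i, ψ i ≤ (1 - θ) * ∑ i ∈ U, ψ i := by linarith
      _ ≤ (1 - θ) * ((1 - θ) ^ r * ∑ i ∈ E, ψ i) :=
          mul_le_mul_of_nonneg_left hsum (by linarith)
      _ = _ := by ring

/-- The word `p` is charged a factor `a` for each letter outside the prescribed sets `A i`. -/
noncomputable def charge {α : Type*} [DecidableEq α] (A : ℕ → Finset α) (a : ℝ) (k : ℕ)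
    (p : ℕ → α) : ℝ :=
  ∏ i ∈ Finset.range k, if p i ∈ A i then 1 else a

lemma card_charge_le {α : Type*} [Fintype α] [DecidableEq α] {A : ℕ → Finset α} {a : ℝ}
    (ha : 0 < a) (hcard : (Fintype.card α : ℝ) ≤ a) {r : ℕ} (hA : ∀ i, (A i).card ≤ r) (k : ℕ)
    {X : ℝ} (hX : 0 ≤ X) (T : Finset (Fin k → α))
    (hT : ∀ w ∈ T, ∃ p : ℕ → α, (∀ i : Fin k, p i = w i) ∧ charge A a k p ≤ X) :
    (T.card : ℝ) ≤ X * (r + 1) ^ k := by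
  have h1 : ∀ w ∈ T, (1 : ℝ) ≤ X * ∏ i : Fin k, if w i ∈ A i then 1 else a⁻¹ := by
    intro w hw
    obtain ⟨p, hp, hle⟩ := hT w hw
    have hpos : 0 < charge A a k p := Finset.prod_pos fun i _ => by split_ifs <;> positivity
    have : (∏ i : Fin k, if w i ∈ A i then (1 : ℝ) else a⁻¹) = (charge A a k p)⁻¹ := by
      rw [charge, ← Fin.prod_univ_eq_prod_range (fun i => if p i ∈ A i then 1 else a) k,
        ← Finset.prod_inv_distrib]
      refine Finset.prod_congr rfl fun i _ => ?_
      rw [hp i]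
      split_ifs <;> simp
    rw [this, ← div_eq_mul_inv, one_le_div hpos]
    exact hle
  calc (T.card : ℝ) = ∑ w ∈ T, 1 := by simp
    _ ≤ ∑ w ∈ T, X * ∏ i : Fin k, (if w i ∈ A i then 1 else a⁻¹) := Finset.sum_le_sum h1
    _ ≤ ∑ w : Fin k → α, X * ∏ i : Fin k, (if w i ∈ A i then 1 else a⁻¹) := by
        refine Finset.sum_le_sum_of_subset_of_nonneg (Finset.subset_univ _) fun w _ _ => ?_
        refine mul_nonneg hX (Finset.prod_nonneg fun i _ => ?_)
        split_ifs <;> positivity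
    _ = X * ∏ i : Fin k, ∑ b : α, (if b ∈ A i then 1 else a⁻¹) := by
        rw [← Finset.mul_sum, Finset.prod_univ_sum, Fintype.piFinset_univ]
    _ ≤ X * ∏ _i : Fin k, ((r : ℝ) + 1) := by
        refine mul_le_mul_of_nonneg_left (Finset.prod_le_prod (fun i _ => ?_) fun i _ => ?_) hX
        · exact Finset.sum_nonneg fun b _ => by split_ifs <;> positivity
        · calc ∑ b : α, (if b ∈ A i then 1 else a⁻¹)
              ≤ ∑ b : α, ((if b ∈ A i then 1 else 0) + a⁻¹) := by
                refine Finset.sum_le_sum fun b _ => ?_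
                have : 0 ≤ a⁻¹ := by positivity
                split_ifs <;> linarith
            _ = (A i).card + Fintype.card α * a⁻¹ := by
                simp [Finset.sum_add_distrib]
            _ ≤ r + 1 := by
                have h2 : (Fintype.card α : ℝ) * a⁻¹ ≤ 1 := by
                  rw [← div_eq_mul_inv]
                  exact div_le_one_of_le₀ hcard ha.le
                have h3 : ((A i).card : ℝ) ≤ r := by exact_mod_cast hA i
                linarith
    _ = X * (r + 1) ^ k := by simp

lemma charge_succ {α : Type*} [DecidableEq α] (A : ℕ → Finset α) (a : ℝ) (k : ℕ)
    (p : ℕ → α) :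
    charge A a (k + 1) p =
      (if p 0 ∈ A 0 then 1 else a) * charge (fun i => A (i + 1)) a k fun i => p (i + 1) := by
  rw [charge, charge, Finset.prod_range_succ', mul_comm]

/-- From rich nodes `S i`, one can choose words which mostly use few letters at each place. -/
lemma exists_selection {α ι : Type*} [Fintype α] [Nonempty α] [DecidableEq α] {d : ℕ → α}
    (E : Finset ι) {J r : ℕ} {a c θ : ℝ} (hc : 1 ≤ c) (hac : a = c ^ J) (hθ0 : 0 < θ)
    (hθ1 : θ ≤ 1) (hr : (1 - θ) ^ r ≤ a⁻¹) (M : ℕ) :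
    ∀ (S : ι → Set ℕ) (q : ι → ℕ) (ψ : ι → ℝ), (∀ i ∈ E, 0 ≤ ψ i) →
      (∀ i ∈ E, Rich d (Fintype.card α * θ) J M (S i) (q i)) →
      ∃ (A : ℕ → Finset α) (s : ι → ℕ), (∀ j, (A j).card ≤ r) ∧ (∀ i ∈ E, s i ∈ S i) ∧
        ∀ k ≤ M, ∑ i ∈ E, ψ i * charge A a k (fun j => d (s i + j)) ≤
          (2 * c) ^ k * ∑ i ∈ E, ψ i * c ^ q i := by
  classical
  have hc0 : 0 < c := by linarith
  have ha1 : 1 ≤ a := hac ▸ one_le_pow₀ hc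
  have ha0 : 0 < a := by linarith
  have hB0 : (0 : ℝ) < Fintype.card α := by exact_mod_cast Fintype.card_pos
  have hzero : ∀ (A : ℕ → Finset α) (s : ι → ℕ) (q : ι → ℕ) (ψ : ι → ℝ), (∀ i ∈ E, 0 ≤ ψ i) →
      ∑ i ∈ E, ψ i * charge A a 0 (fun j => d (s i + j)) ≤
          (2 * c) ^ 0 * ∑ i ∈ E, ψ i * c ^ q i := by
    intro A s q ψ hψ
    rw [pow_zero, one_mul]
    refine Finset.sum_le_sum fun i hi => mul_le_mul_of_nonneg_left ?_ (hψ i hi)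
    simpa [charge] using one_le_pow₀ hc
  induction M with
  | zero =>
    intro S q ψ hψ h
    choose! s hs using h
    refine ⟨fun _ => ∅, s, by simp, hs, fun k hk => ?_⟩
    obtain rfl : k = 0 := by omega
    exact hzero _ _ _ _ hψ
  | succ M ih =>
    intro S q ψ hψ h
    set ψc : ι → ℝ := fun i => ψ i * c ^ q i with hψc
    have hψc0 : ∀ i ∈ E, 0 ≤ ψc i := fun i hi => mul_nonneg (hψ i hi) (by positivity)
    set G : ι → Finset α := fun i =>
      Finset.univ.filter fun b => Rich d (Fintype.card α * θ) J M (child d b (S i)) (q i + 1)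
      with hG
    set E₁ := E.filter fun i => Fintype.card α * θ < (G i).card with hE₁
    have hE₁E : E₁ ⊆ E := Finset.filter_subset _ _
    obtain ⟨A₀, hA₀, hmiss⟩ := exists_hitting_set E₁ G (fun i hi => hψc0 i (hE₁E hi)) hθ1
      (fun i hi => (Finset.mem_filter.mp hi).2.le) r
    set U := E₁.filter fun i => Disjoint (G i) A₀ with hU
    have hUE : U ⊆ E := (Finset.filter_subset _ _).trans hE₁E
    have hstep : ∀ i ∈ E, ∃ b q', Rich d (Fintype.card α * θ) J M (child d b (S i)) q' ∧
        (if b ∈ A₀ then 1 else a) * c ^ q' ≤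
          c * c ^ q i + if i ∈ U then a * c * c ^ q i else 0 := by
      intro i hi
      have hnn : (0 : ℝ) ≤ if i ∈ U then a * c * c ^ q i else 0 := by
        split_ifs <;> positivity
      by_cases hi₁ : i ∈ E₁
      · by_cases hiU : i ∈ U
        · have hpos : 0 < (G i).card := by
            have := (Finset.mem_filter.mp hi₁).2
            exact_mod_cast (mul_pos hB0 hθ0).trans this
          obtain ⟨b, hb⟩ := Finset.card_pos.mp hpos
          refine ⟨b, q i + 1, (Finset.mem_filter.mp hb).2, ?_⟩
          have hle : (if b ∈ A₀ then 1 else a) ≤ a := by split_ifs <;> linarith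
          rw [if_pos hiU, pow_succ]
          have h1 : 0 < c ^ q i * c := by positivity
          nlinarith [mul_le_mul_of_nonneg_right hle h1.le]
        · have : ¬ Disjoint (G i) A₀ := fun hd => hiU (Finset.mem_filter.mpr ⟨hi₁, hd⟩)
          obtain ⟨b, hb, hbA⟩ := Finset.not_disjoint_iff.mp this
          refine ⟨b, q i + 1, (Finset.mem_filter.mp hb).2, ?_⟩
          rw [if_pos hbA, if_neg hiU, pow_succ]
          linarith
      · have hR := h i hi
        have hcard : (({b | Rich d (Fintype.card α * θ) J M (child d b (S i)) (q i + 1)} :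
            Set α).ncard : ℝ) = ((G i).card : ℝ) := by
          rw [← ncard_coe_finset, hG]
          simp
        rw [Rich, hcard] at hR
        rcases hR with hR | ⟨hJ, b, hb⟩
        · exact absurd (Finset.mem_filter.mpr ⟨hi, hR⟩) hi₁
        · refine ⟨b, q i - J, hb, ?_⟩
          have hle : (if b ∈ A₀ then 1 else a) ≤ a := by split_ifs <;> linarith
          have h1 : a * c ^ (q i - J) = c ^ q i := by
            rw [hac, ← pow_add]
            congr 1
            omega
          have h2 : 0 < c ^ (q i - J) := by positivity
          have h3 : 0 < c ^ q i := by positivity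
          nlinarith [mul_le_mul_of_nonneg_right hle h2.le]
    choose! b q' hrich hcost using hstep
    set ψ' : ι → ℝ := fun i => ψ i * if b i ∈ A₀ then 1 else a with hψ'
    have hψ'0 : ∀ i ∈ E, 0 ≤ ψ' i := fun i hi => by
      refine mul_nonneg (hψ i hi) ?_
      split_ifs <;> linarith
    obtain ⟨A, s, hA, hs, hsum⟩ := ih (fun i => child d (b i) (S i)) q' ψ' hψ'0 hrich
    have htotal : ∑ i ∈ E, ψ' i * c ^ q' i ≤ 2 * c * ∑ i ∈ E, ψc i := by
      calc ∑ i ∈ E, ψ' i * c ^ q' i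
          ≤ ∑ i ∈ E, (c * ψc i + if i ∈ U then a * c * ψc i else 0) := by
            refine Finset.sum_le_sum fun i hi => ?_
            have := mul_le_mul_of_nonneg_left (hcost i hi) (hψ i hi)
            simp only [hψ', hψc]
            split_ifs at this ⊢ <;> nlinarith
        _ = c * ∑ i ∈ E, ψc i + a * c * ∑ i ∈ U, ψc i := by
            rw [Finset.sum_add_distrib, ← Finset.mul_sum, ← Finset.sum_filter,
              Finset.filter_mem_eq_inter, Finset.inter_eq_right.mpr hUE, ← Finset.mul_sum]
        _ ≤ c * ∑ i ∈ E, ψc i + a * c * (a⁻¹ * ∑ i ∈ E, ψc i) := by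
            have h1 : ∑ i ∈ E₁, ψc i ≤ ∑ i ∈ E, ψc i :=
              Finset.sum_le_sum_of_subset_of_nonneg hE₁E fun i hi _ => hψc0 i hi
            have h2 : 0 ≤ ∑ i ∈ E₁, ψc i := Finset.sum_nonneg fun i hi => hψc0 i (hE₁E hi)
            have h3 : ∑ i ∈ U, ψc i ≤ a⁻¹ * ∑ i ∈ E, ψc i :=
              hmiss.trans (mul_le_mul hr h1 h2 (by positivity))
            gcongr
        _ = 2 * c * ∑ i ∈ E, ψc i := by
            field_simp
            ring
    choose! t ht using hs
    refine ⟨fun j => Nat.casesOn j A₀ A, t, ?_, fun i hi => (ht i hi).1, ?_⟩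
    · rintro (_ | j)
      · exact hA₀
      · exact hA j
    · rintro (_ | k) hk
      · exact hzero _ _ _ _ hψ
      · calc ∑ i ∈ E, ψ i * charge (fun j => Nat.casesOn j A₀ A) a (k + 1) (fun j => d (t i + j))
            = ∑ i ∈ E, ψ' i * charge A a k (fun j => d (s i + j)) := by
              refine Finset.sum_congr rfl fun i hi => ?_
              obtain ⟨-, h1, h2⟩ := ht i hi
              rw [charge_succ, ← mul_assoc]
              simp only [hψ', add_zero, h1, h2]
              congr 2
              funext j
              congr 1
              ring
          _ ≤ (2 * c) ^ k * (2 * c * ∑ i ∈ E, ψc i) :=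
              (hsum k (by omega)).trans (mul_le_mul_of_nonneg_left htotal (by positivity))
          _ = (2 * c) ^ (k + 1) * ∑ i ∈ E, ψc i := by ring

end Selection

section Rotation

lemma separated_fractions {R r r' : ℕ} (hr : r < R) (hr' : r' < R) (hne : r ≠ r') :
    1 / (R : ℝ) ≤ ‖(((r / R : ℝ) : UnitAddCircle) - ((r' / R : ℝ) : UnitAddCircle))‖ := by
  have hR : (0 : ℝ) < R := by exact_mod_cast (by omega : 0 < R)
  rw [← AddCircle.coe_sub, UnitAddCircle.norm_eq]
  set z := round ((r / R : ℝ) - r' / R) with hz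
  have h1 : (r / R : ℝ) - r' / R - z = (((r : ℤ) - r' - R * z : ℤ) : ℝ) / R := by
    push_cast
    field_simp
  rw [h1, abs_div, abs_of_pos hR]
  refine div_le_div_of_nonneg_right ?_ hR.le
  rw [← Int.cast_abs]
  have h2 : (r : ℤ) - r' - R * z ≠ 0 := by
    intro h
    have hdvd : (R : ℤ) ∣ (r : ℤ) - r' := ⟨z, by linarith⟩
    have := Int.eq_zero_of_abs_lt_dvd hdvd (by rw [abs_lt]; omega)
    omega
  exact_mod_cast Int.one_le_abs h2

/-- Orbit segments of an irrational rotation visit short arcs proportionally rarely. -/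
lemma exists_visits_le {u : UnitAddCircle} (hu : DenseRange fun z : ℤ => z • u) {ℓ : ℝ}
    (hℓ : 0 < ℓ) :
    ∃ K₁ : ℕ, ∀ K ≥ K₁, ∀ n₀ c, ∀ Q ⊆ Finset.Ico n₀ (n₀ + K), (∀ n ∈ Q, ‖n • u - c‖ ≤ ℓ) →
      (Q.card : ℝ) ≤ 16 * ℓ * K := by
  classical
  by_cases hbig : 1 < 4 * ℓ
  · refine ⟨0, fun K _ n₀ c Q hQ _ => ?_⟩
    have h1 : Q.card ≤ K := by simpa using Finset.card_le_card hQ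
    have h2 : (Q.card : ℝ) ≤ K := by exact_mod_cast h1
    have h3 : (0 : ℝ) ≤ K := by positivity
    nlinarith
  push Not at hbig
  set R := ⌊1 / (4 * ℓ)⌋₊ with hR
  have hR1 : 1 ≤ R := Nat.le_floor (by rw [Nat.cast_one, le_div_iff₀ (by positivity)]; linarith)
  have hR2 : (R : ℝ) * (4 * ℓ) ≤ 1 := by
    rw [← le_div_iff₀ (by positivity)]
    exact Nat.floor_le (by positivity)
  have hR3 : 1 ≤ 8 * ℓ * R := by
    have h1 : 1 / (4 * ℓ) < R + 1 := Nat.lt_floor_add_one _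
    rw [div_lt_iff₀ (by positivity)] at h1
    have h2 : (1 : ℝ) ≤ R := by exact_mod_cast hR1
    nlinarith
  have hRpos : (0 : ℝ) < R := by exact_mod_cast hR1
  have hm : ∀ r : ℕ, ∃ m : ℤ, ‖m • u - ((r / R : ℝ) : UnitAddCircle)‖ < ℓ := fun r => by
    obtain ⟨m, hm⟩ := hu.exists_dist_lt ((r / R : ℝ) : UnitAddCircle) hℓ
    exact ⟨m, by rwa [dist_comm, dist_eq_norm] at hm⟩
  choose m hm using hm
  set Z := ∑ r ∈ Finset.range R, (m r).natAbs with hZ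
  have hmZ : ∀ r < R, |m r| ≤ Z := fun r hr => by
    have : (m r).natAbs ≤ Z :=
      Finset.single_le_sum (f := fun r => (m r).natAbs) (fun _ _ => Nat.zero_le _)
        (Finset.mem_range.mpr hr)
    rw [Int.abs_eq_natAbs]
    exact_mod_cast this
  refine ⟨2 * Z + 1, fun K hK n₀ c Q hQ hQc => ?_⟩
  have hcard : R * Q.card ≤ K + 2 * Z := by
    have hmaps : ∀ p ∈ Finset.range R ×ˢ Q,
        (p.2 : ℤ) + m p.1 ∈ Finset.Ico ((n₀ : ℤ) - Z) (n₀ + K + Z) := by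
      rintro ⟨r, n⟩ hp
      simp only [Finset.mem_product, Finset.mem_range] at hp
      have h1 := abs_le.mp (hmZ r hp.1)
      have h2 := Finset.mem_Ico.mp (hQ hp.2)
      simp only [Finset.mem_Ico]
      omega
    have hinj : Set.InjOn (fun p : ℕ × ℕ => (p.2 : ℤ) + m p.1)
        (Finset.range R ×ˢ Q : Finset (ℕ × ℕ)) := by
      rintro ⟨r, n⟩ hp ⟨r', n'⟩ hp' heq
      simp only [Finset.coe_product, Set.mem_prod, Finset.mem_coe, Finset.mem_range] at hp hp'
      simp only at heq
      have hrr : r = r' := by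
        by_contra hne
        have hsep := separated_fractions hp.1 hp'.1 hne
        have h4 : 4 * ℓ ≤ 1 / (R : ℝ) := by
          rw [le_div_iff₀ hRpos]
          linarith
        have hu1 : (n : ℤ) • u + m r • u = (n' : ℤ) • u + m r' • u := by
          rw [← add_smul, ← add_smul, heq]
        rw [natCast_zsmul, natCast_zsmul] at hu1
        have hid : ((r / R : ℝ) : UnitAddCircle) - ((r' / R : ℝ) : UnitAddCircle) =
            (m r' • u - ((r' / R : ℝ) : UnitAddCircle)) -
              (m r • u - ((r / R : ℝ) : UnitAddCircle)) +
              ((n' • u - c) - (n • u - c)) := by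
          have : m r • u = n' • u + m r' • u - n • u := by rw [← hu1]; abel
          rw [this]
          abel
        rw [hid] at hsep
        have h5 := norm_add_le ((m r' • u - ((r' / R : ℝ) : UnitAddCircle)) -
              (m r • u - ((r / R : ℝ) : UnitAddCircle))) ((n' • u - c) - (n • u - c))
        have h6 := norm_sub_le (m r' • u - ((r' / R : ℝ) : UnitAddCircle))
          (m r • u - ((r / R : ℝ) : UnitAddCircle))
        have h7 := norm_sub_le (n' • u - c) (n • u - c)
        have h8 := hQc n hp.2
        have h9 := hQc n' hp'.2
        have h10 := hm r
        have h11 := hm r'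
        linarith
      subst hrr
      have : n = n' := by exact_mod_cast add_right_cancel heq
      rw [this]
    have := Finset.card_le_card_of_injOn _ hmaps hinj
    rw [Finset.card_product, Finset.card_range, Int.card_Ico] at this
    omega
  have h1 : (R : ℝ) * Q.card ≤ 2 * K := by
    have : R * Q.card ≤ 2 * K := by omega
    exact_mod_cast this
  have h2 : (0 : ℝ) ≤ Q.card := by positivity
  nlinarith [mul_le_mul_of_nonneg_left h1 hℓ.le]

/-- The times at which the orbit of `0` is `ρ`-close to `n • u`. -/
def rotationTube (u : UnitAddCircle) (ρ : ℝ) (n : ℕ) : Set ℕ := {m | ‖m • u - n • u‖ ≤ ρ}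

lemma child_rotationTube_subset {α : Type*} (d : ℕ → α) (u : UnitAddCircle) (ρ : ℝ) (n : ℕ)
    (b : α) : child d b (rotationTube u ρ n) ⊆ rotationTube u ρ (n + 1) := by
  rintro _ ⟨m, hm, -, rfl⟩
  simpa [rotationTube, add_smul] using hm

lemma exists_rotationTube_cover (u : UnitAddCircle) {ρ : ℝ} (hρ : 0 < ρ) :
    ∃ F : Finset ℕ, univ ⊆ ⋃ n ∈ F, rotationTube u ρ n := by
  have htb : TotallyBounded (range fun n : ℕ => n • u) :=
    isCompact_univ.totallyBounded.subset (subset_univ _)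
  obtain ⟨t, ht, htf, hcov⟩ := htb.exists_subset (Metric.dist_mem_uniformity hρ)
  have ht' : ∀ z ∈ t, ∃ n : ℕ, n • u = z := fun z hz => ht hz
  choose! f hf using ht'
  refine ⟨htf.toFinset.image f, fun m _ => ?_⟩
  have h := hcov (mem_range_self m)
  simp only [mem_iUnion] at h
  obtain ⟨z, hz, hmz⟩ := h
  simp only [mem_iUnion, Finset.mem_image, Finite.mem_toFinset]
  refine ⟨f z, ⟨z, hz, rfl⟩, ?_⟩
  have h2 : f z • u = z := hf z hz
  have h3 : dist (m • u) z < ρ := hmz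
  rw [rotationTube, mem_ofPred_eq, h2, ← dist_eq_norm]
  exact h3.le

end Rotation

/-- A lower bound for the efficiency of finite covers of the points `n • u + y n`, where the
position of `y n` is coded by a sequence `d` with almost as many words as its number of letters
permits. -/
theorem one_le_cover_sum {α : Type*} [Fintype α] [Nonempty α] {d : ℕ → α}
    {u : UnitAddCircle} (hu : DenseRange fun z : ℤ => z • u) {y : ℕ → UnitAddCircle}
    {c e θ : ℝ} {J r : ℕ} (hJ : J ≠ 0) (he : 4 ≤ e) (hθ : θ = (1 / (4 * e ^ 2)) ^ (J + 1))
    (hcard : (Fintype.card α : ℝ) ≤ e ^ (J * J)) (hc : 0 < c)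
    (hgrowth : ∀ K, c * (Fintype.card α / e) ^ K ≤ wordCount d K univ)
    (hr : (1 - θ) ^ r ≤ (e ^ (J * J))⁻¹)
    (hy : ∀ k n n', (∀ i < k, d (n + i) = d (n' + i)) → ‖y n - y n'‖ ≤ ((e ^ (J * J)) ^ k)⁻¹)
    {ι : Type*} (T : Finset ι) (x : ι → UnitAddCircle) (k : ι → ℕ)
    (hcover : ∀ n : ℕ, ∃ i ∈ T, ‖n • u + y n - x i‖ ≤ ((e ^ (J * J)) ^ k i)⁻¹) :
    1 ≤ 192 * e ^ (J * J) * ∑ i ∈ T, ((e ^ J) ^ 2 * (r + 1) / e ^ (J * J)) ^ k i := by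
  classical
  set a := e ^ (J * J) with ha
  set b := e ^ J with hb
  have hab : a = b ^ J := by rw [ha, hb, pow_mul]
  have hb4 : 4 ≤ b := he.trans (le_self_pow₀ (by linarith) hJ)
  have ha4 : 4 ≤ a := he.trans (le_self_pow₀ (by linarith) (mul_ne_zero hJ hJ))
  have ha0 : 0 < a := by linarith
  have hb0 : 0 < b := by linarith
  have he2 : (1 : ℝ) / (4 * e ^ 2) ≤ 1 := by
    rw [div_le_one (by positivity)]
    nlinarith
  have hθ0 : 0 < θ := by rw [hθ]; positivity
  have hθ1 : θ ≤ 1 := by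
    rw [hθ]
    exact pow_le_one₀ (by positivity) he2
  set M := T.sup k with hM
  have hkM : ∀ i ∈ T, k i ≤ M := fun i hi => Finset.le_sup hi
  set ρ := (a ^ M)⁻¹ with hρ
  have hρ0 : 0 < ρ := by positivity
  obtain ⟨F, hF⟩ := exists_rotationTube_cover u hρ0
  obtain ⟨K₁, hK₁⟩ := exists_window_rich hc (by linarith) hgrowth
    (fun n b => child_rotationTube_subset d u ρ n b) hF J M
  have hvis : ∀ j : ℕ, (0 : ℝ) < 3 * (a ^ j)⁻¹ := fun j => by positivity
  choose K₂ hK₂ using fun j => exists_visits_le hu (hvis j)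
  set K := K₁ + (Finset.range (M + 1)).sup K₂ + 1 with hK
  have hKK₂ : ∀ j ≤ M, K₂ j ≤ K := fun j hj => by
    have := Finset.le_sup (f := K₂) (Finset.mem_range.mpr (show j < M + 1 by omega))
    omega
  obtain ⟨n₀, E, hE, hEcard, hrich⟩ := hK₁ K (by omega)
  rw [← hθ] at hrich
  obtain ⟨A, s, hA, hs, hsum⟩ := exists_selection (d := d) E (one_le_pow₀ (by linarith)) hab hθ0
    hθ1 hr M (rotationTube u ρ) (fun _ => 0) (fun _ => 1) (fun _ _ => zero_le_one) hrich
  simp only [one_mul, pow_zero, Finset.sum_const, nsmul_eq_mul, mul_one] at hsum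
  set ch : ℕ → ℕ → ℝ := fun j n => charge A a j fun i => d (s n + i) with hch
  have hch0 : ∀ j n, 0 ≤ ch j n := fun j n =>
    Finset.prod_nonneg fun i _ => by split_ifs <;> linarith
  set Bad : ℕ → Finset ℕ := fun j => E.filter fun n => a * b ^ (2 * j) < ch j n with hBad
  have hBadcard : ∀ j ≤ M, ((Bad j).card : ℝ) ≤ E.card / a * (1 / 2) ^ j := by
    intro j hj
    have h1 : (Bad j).card * (a * b ^ (2 * j)) ≤ (2 * b) ^ j * E.card := by
      calc (Bad j).card * (a * b ^ (2 * j)) = ∑ n ∈ Bad j, a * b ^ (2 * j) := by simp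
        _ ≤ ∑ n ∈ Bad j, ch j n :=
            Finset.sum_le_sum fun n hn => (Finset.mem_filter.mp hn).2.le
        _ ≤ ∑ n ∈ E, ch j n :=
            Finset.sum_le_sum_of_subset_of_nonneg (Finset.filter_subset _ _) fun n _ _ => hch0 j n
        _ ≤ _ := hsum j hj
    have h2 : (2 * b) ^ j ≤ (1 / 2) ^ j * b ^ (2 * j) := by
      rw [pow_mul, ← mul_pow]
      refine pow_le_pow_left₀ (by positivity) ?_ j
      nlinarith
    rw [div_mul_eq_mul_div, le_div_iff₀ ha0]
    have h3 : (0 : ℝ) < b ^ (2 * j) := by positivity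
    refine le_of_mul_le_mul_right ?_ h3
    calc (Bad j).card * a * b ^ (2 * j) ≤ (2 * b) ^ j * E.card := by linarith
      _ ≤ (1 / 2) ^ j * b ^ (2 * j) * E.card := by gcongr
      _ = _ := by ring
  set Q : ι → Finset ℕ := fun i => E.filter fun n =>
    ‖s n • u + y (s n) - x i‖ ≤ (a ^ k i)⁻¹ ∧ ch (k i) n ≤ a * b ^ (2 * k i) with hQ
  have hEsub : E ⊆ (Finset.range (M + 1)).biUnion Bad ∪ T.biUnion Q := by
    intro n hn
    obtain ⟨i, hi, hin⟩ := hcover (s n)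
    simp only [Finset.mem_union, Finset.mem_biUnion, Finset.mem_range]
    by_cases hgood : ch (k i) n ≤ a * b ^ (2 * k i)
    · exact Or.inr ⟨i, hi, Finset.mem_filter.mpr ⟨hn, hin, hgood⟩⟩
    · exact Or.inl ⟨k i, Nat.lt_succ_of_le (hkM i hi),
        Finset.mem_filter.mpr ⟨hn, not_le.mp hgood⟩⟩
  have hBadsum : (((Finset.range (M + 1)).biUnion Bad).card : ℝ) ≤ E.card / 2 := by
    calc (((Finset.range (M + 1)).biUnion Bad).card : ℝ)
        ≤ ∑ j ∈ Finset.range (M + 1), ((Bad j).card : ℝ) := by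
          exact_mod_cast Finset.card_biUnion_le
      _ ≤ ∑ j ∈ Finset.range (M + 1), E.card / a * (1 / 2 : ℝ) ^ j :=
          Finset.sum_le_sum fun j hj => hBadcard j (Nat.lt_succ_iff.mp (Finset.mem_range.mp hj))
      _ ≤ E.card / a * 2 := by
          rw [← Finset.mul_sum]
          exact mul_le_mul_of_nonneg_left (sum_geometric_two_le _) (by positivity)
      _ ≤ E.card / 4 * 2 := by gcongr
      _ = E.card / 2 := by ring
  have hK0 : (0 : ℝ) < K := by exact_mod_cast (by omega : 0 < K)
  have hQcard : ∀ i ∈ T, ((Q i).card : ℝ) ≤ 48 * a * K * (b ^ 2 * (r + 1) / a) ^ k i := by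
    intro i hi
    set j := k i with hj
    set N : ℕ := ⌊16 * (3 * (a ^ j)⁻¹) * (K : ℝ)⌋₊ with hN
    have hfib : ∀ w ∈ (Q i).image fun n => word d j (s n),
        ((Q i).filter fun n => word d j (s n) = w).card ≤ N := by
      intro w hw
      obtain ⟨n₁, hn₁, hw₁⟩ := Finset.mem_image.mp hw
      refine Nat.le_floor (hK₂ j K (hKK₂ j (hkM i hi)) n₀ (x i - y (s n₁)) _ ?_ ?_)
      · exact ((Finset.filter_subset _ _).trans (Finset.filter_subset _ _)).trans hE
      · intro n hn
        obtain ⟨hnQ, hnw⟩ := Finset.mem_filter.mp hn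
        obtain ⟨hnE, hclose, -⟩ := Finset.mem_filter.mp hnQ
        have h1 : ‖y (s n) - y (s n₁)‖ ≤ (a ^ j)⁻¹ := by
          refine hy j _ _ fun l hl => ?_
          exact congrFun (hnw.trans hw₁.symm) ⟨l, hl⟩
        have h2 : ‖s n • u - n • u‖ ≤ (a ^ j)⁻¹ := by
          refine le_trans (hs n hnE) ?_
          exact inv_anti₀ (by positivity) (pow_le_pow_right₀ (by linarith) (hkM i hi))
        have hid : n • u - (x i - y (s n₁)) =
            (s n • u + y (s n) - x i) - (s n • u - n • u) - (y (s n) - y (s n₁)) := by abel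
        rw [hid]
        have h3 := norm_sub_le ((s n • u + y (s n) - x i) - (s n • u - n • u))
          (y (s n) - y (s n₁))
        have h4 := norm_sub_le (s n • u + y (s n) - x i) (s n • u - n • u)
        linarith
    have hwords : (((Q i).image fun n => word d j (s n)).card : ℝ) ≤
        a * b ^ (2 * j) * (r + 1) ^ j := by
      refine card_charge_le ha0 hcard hA j (by positivity) _ fun w hw => ?_
      obtain ⟨n, hn, rfl⟩ := Finset.mem_image.mp hw
      exact ⟨fun l => d (s n + l), fun l => rfl, (Finset.mem_filter.mp hn).2.2⟩
    have h1 : ((Q i).card : ℝ) ≤ N * (((Q i).image fun n => word d j (s n)).card : ℝ) := by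
      exact_mod_cast Finset.card_le_mul_card_image (Q i) N hfib
    have h2 : (N : ℝ) ≤ 16 * (3 * (a ^ j)⁻¹) * K := Nat.floor_le (by positivity)
    calc ((Q i).card : ℝ) ≤ 16 * (3 * (a ^ j)⁻¹) * K * (a * b ^ (2 * j) * (r + 1) ^ j) :=
          h1.trans (mul_le_mul h2 hwords (by positivity) (by positivity))
      _ = 48 * a * K * (b ^ 2 * (r + 1) / a) ^ j := by
          rw [div_pow, mul_pow, ← pow_mul, div_eq_mul_inv]
          ring
  have hEle : (E.card : ℝ) ≤ E.card / 2 +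
      ∑ i ∈ T, 48 * a * K * (b ^ 2 * (r + 1) / a) ^ k i := by
    have h1 : E.card ≤ ((Finset.range (M + 1)).biUnion Bad).card + ∑ i ∈ T, (Q i).card :=
      ((Finset.card_le_card hEsub).trans (Finset.card_union_le _ _)).trans
        (Nat.add_le_add_left Finset.card_biUnion_le _)
    have h2 : (E.card : ℝ) ≤ (((Finset.range (M + 1)).biUnion Bad).card : ℝ) +
        ∑ i ∈ T, ((Q i).card : ℝ) := by exact_mod_cast h1
    exact h2.trans (add_le_add hBadsum (Finset.sum_le_sum hQcard))
  rw [← Finset.mul_sum] at hEle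
  have hEK : (K : ℝ) < 2 * E.card := by exact_mod_cast hEcard
  set tot := ∑ i ∈ T, (b ^ 2 * (r + 1) / a) ^ k i
  have hfin : (1 : ℝ) * K ≤ 192 * a * tot * K := by nlinarith
  exact le_of_mul_le_mul_right hfin hK0

section Cover

open scoped ENNReal NNReal

/-- A compact set of vanishing Hausdorff measure has finite covers by balls whose radii are powers
of `ρ`, of arbitrarily small cost. -/
lemma exists_finite_cover_of_hausdorffMeasure_eq_zero {X : Type*} [MetricSpace X] [Nonempty X]
    [MeasurableSpace X] [BorelSpace X] {A : Set X} (hA : IsCompact A) {s : ℝ} (hs : 0 < s)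
    (h0 : μH[s] A = 0) {ρ : ℝ} (hρ0 : 0 < ρ) (hρ1 : ρ < 1) {η : ℝ} (hη : 0 < η) :
    ∃ (T : Finset ℕ) (x : ℕ → X) (k : ℕ → ℕ),
      (∀ z ∈ A, ∃ n ∈ T, dist z (x n) ≤ ρ ^ k n) ∧ ∑ n ∈ T, (ρ ^ k n) ^ s < η := by
  set ε : ℝ := min 1 (η * ρ ^ s) / 2 with hε_def
  have hρs : 0 < ρ ^ s := Real.rpow_pos_of_pos hρ0 s
  have hε : 0 < ε := by positivity
  have hε1 : ε + ε ≤ 1 := by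
    have := min_le_left 1 (η * ρ ^ s)
    linarith
  have hε2 : ε + ε ≤ η * ρ ^ s := by
    have := min_le_right 1 (η * ρ ^ s)
    linarith
  have hε' : ENNReal.ofReal ε ≠ 0 := by simpa using hε
  rw [Measure.hausdorffMeasure_apply] at h0
  have h1 := le_of_eq h0
  simp only [iSup_le_iff] at h1
  have h2 := (h1 1 one_pos).trans_lt (pos_iff_ne_zero.2 hε')
  simp only [iInf_lt_iff] at h2
  obtain ⟨t, ht, -, hsum⟩ := h2
  obtain ⟨δ, hδ0, hδ⟩ := ENNReal.exists_pos_sum_of_countable hε' ℕ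
  set c : ℕ → ℝ≥0∞ := fun n => ⨆ _ : (t n).Nonempty, Metric.ediam (t n) ^ s with hc
  set w : ℕ → ℝ≥0∞ := fun n => c n + δ n with hw
  have hwsum : ∑' n, w n < ENNReal.ofReal (ε + ε) := by
    rw [hw, ENNReal.tsum_add, ENNReal.ofReal_add hε.le hε.le]
    exact ENNReal.add_lt_add hsum hδ
  have hwle : ∀ n, w n ≤ ENNReal.ofReal (ε + ε) := fun n => (ENNReal.le_tsum n).trans hwsum.le
  have hwtop : ∀ n, w n ≠ ∞ := fun n => ((hwle n).trans_lt ENNReal.ofReal_lt_top).ne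
  have hw0 : ∀ n, 0 < (w n).toReal := fun n => by
    refine ENNReal.toReal_pos ?_ (hwtop n)
    simp [hw, (hδ0 n).ne']
  set R : ℕ → ℝ := fun n => (w n).toReal ^ (1 / s) with hR
  have hR0 : ∀ n, 0 < R n := fun n => Real.rpow_pos_of_pos (hw0 n) _
  have hRs : ∀ n, R n ^ s = (w n).toReal := fun n => by
    rw [hR, ← Real.rpow_mul (hw0 n).le, one_div_mul_cancel hs.ne', Real.rpow_one]
  have hR1 : ∀ n, R n ≤ 1 := fun n => by
    refine Real.rpow_le_one (hw0 n).le ?_ (by positivity)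
    exact (ENNReal.toReal_le_of_le_ofReal (by positivity) (hwle n)).trans hε1
  choose k hk1 hk2 using fun n => exists_nat_pow_near_of_lt_one (hR0 n) (hR1 n) hρ0 hρ1
  have hx : ∀ n, ∃ x, t n ⊆ Metric.ball x (R n) := fun n => by
    rcases (t n).eq_empty_or_nonempty with h | ⟨x, hx⟩
    · exact ⟨Classical.arbitrary X, by simp [h]⟩
    · refine ⟨x, fun z hz => ?_⟩
      rw [Metric.mem_ball, ← ENNReal.ofReal_lt_ofReal_iff (hR0 n), ← edist_dist]
      refine (Metric.edist_le_ediam_of_mem hz hx).trans_lt ?_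
      rw [← ENNReal.rpow_lt_rpow_iff hs, ENNReal.ofReal_rpow_of_pos (hR0 n), hRs,
        ENNReal.ofReal_toReal (hwtop n)]
      have h3 : Metric.ediam (t n) ^ s ≤ c n := le_iSup (fun _ : (t n).Nonempty => _) ⟨x, hx⟩
      refine h3.trans_lt (ENNReal.lt_add_right ?_ ?_)
      · exact fun h => hwtop n (by simp [hw, h])
      · exact_mod_cast (hδ0 n).ne'
  choose x hx using hx
  obtain ⟨T, hT⟩ := hA.elim_finite_subcover (fun n => Metric.ball (x n) (R n))
    (fun n => Metric.isOpen_ball) (ht.trans (iUnion_mono hx))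
  refine ⟨T, x, k, fun z hz => ?_, ?_⟩
  · obtain ⟨n, hn, hzn⟩ := mem_iUnion₂.1 (hT hz)
    exact ⟨n, hn, (Metric.mem_ball.1 hzn).le.trans (hk2 n)⟩
  · have h4 : ∀ n, (ρ ^ k n) ^ s * ρ ^ s ≤ (w n).toReal := fun n => by
      rw [← Real.mul_rpow (by positivity) hρ0.le, ← pow_succ, ← hRs]
      exact Real.rpow_le_rpow (by positivity) (hk1 n).le hs.le
    have h5 : ∑ n ∈ T, (w n).toReal < ε + ε := by
      rw [← ENNReal.toReal_sum fun n _ => hwtop n]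
      exact ENNReal.toReal_lt_of_lt_ofReal ((ENNReal.sum_le_tsum T).trans_lt hwsum)
    have h6 := Finset.sum_le_sum fun n (_ : n ∈ T) => h4 n
    rw [← Finset.sum_mul] at h6
    nlinarith

end Cover

section Parameters

/-- For a large base `e`, a number of steps exists which makes the growth factor of
`one_le_cover_sum` as small as the cost of a ball in dimension `s`. -/
lemma exists_steps {s : ℝ} {J : ℕ} (hJ : 5 * J + 6 ≤ (J : ℝ) ^ 2 * (1 - s)) {e θ : ℝ}
    (he : 4 ≤ e) (heJ : (J : ℝ) ^ 2 ≤ e) (hθ : θ = (1 / (4 * e ^ 2)) ^ (J + 1)) :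
    ∃ r : ℕ, (1 - θ) ^ r ≤ (e ^ (J * J))⁻¹ ∧
      (e ^ J) ^ 2 * (r + 1) / e ^ (J * J) ≤ ((e ^ (J * J))⁻¹) ^ s := by
  have he0 : 0 < e := by linarith
  have he1 : 1 ≤ e := by linarith
  have hlog0 : 0 ≤ Real.log e := Real.log_nonneg he1
  have hlog : Real.log e ≤ e := (Real.log_le_sub_one_of_pos he0).trans (by linarith)
  have hθ0 : 0 < θ := by rw [hθ]; positivity
  have hθ1 : θ ≤ 1 := by
    rw [hθ]
    refine pow_le_one₀ (by positivity) ?_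
    rw [div_le_one (by positivity)]
    nlinarith
  have hθinv : θ⁻¹ ≤ e ^ (3 * J + 3) := by
    rw [hθ, one_div, inv_pow, inv_inv, show 3 * J + 3 = 3 * (J + 1) by ring, pow_mul]
    refine pow_le_pow_left₀ (by positivity) ?_ _
    nlinarith [sq_nonneg e]
  set N : ℝ := (J : ℝ) ^ 2 * Real.log e * θ⁻¹ with hN
  have hN0 : 0 ≤ N := by positivity
  have hNle : N ≤ e ^ (3 * J + 5) := by
    calc N ≤ e * e * e ^ (3 * J + 3) := by rw [hN]; gcongr
      _ = e ^ (3 * J + 5) := by ring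
  refine ⟨⌈N⌉₊, ?_, ?_⟩
  · have h1 : (1 - θ) ^ ⌈N⌉₊ ≤ Real.exp (-θ) ^ ⌈N⌉₊ := by
      refine pow_le_pow_left₀ (by linarith) ?_ _
      linarith [Real.add_one_le_exp (-θ)]
    refine h1.trans ?_
    rw [← Real.exp_nat_mul, ← Real.exp_log (pow_pos he0 (J * J)), ← Real.exp_neg,
      Real.exp_le_exp, Real.log_pow]
    have h2 : N * θ ≤ ⌈N⌉₊ * θ := by gcongr; exact Nat.le_ceil N
    have h3 : N * θ = (J : ℝ) ^ 2 * Real.log e := by rw [hN]; field_simp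
    push_cast
    nlinarith
  · have h1 : (⌈N⌉₊ : ℝ) + 1 ≤ e ^ (3 * J + 6) := by
      have h2 := (Nat.ceil_lt_add_one hN0).le
      have h3 : 1 ≤ e ^ (3 * J + 5) := one_le_pow₀ he1
      have h4 : e ^ (3 * J + 6) = e * e ^ (3 * J + 5) := by ring
      nlinarith
    rw [div_le_iff₀ (by positivity)]
    calc (e ^ J) ^ 2 * (⌈N⌉₊ + 1) ≤ (e ^ J) ^ 2 * e ^ (3 * J + 6) := by gcongr
      _ = e ^ ((5 * J + 6 : ℕ) : ℝ) := by rw [Real.rpow_natCast]; ring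
      _ ≤ e ^ ((J : ℝ) ^ 2 * (1 - s)) :=
        Real.rpow_le_rpow_of_exponent_le he1 (by push_cast; exact hJ)
      _ = ((e ^ (J * J))⁻¹) ^ s * e ^ (J * J) := by
        rw [← Real.rpow_natCast e (J * J), ← Real.rpow_neg he0.le, ← Real.rpow_mul he0.le,
          ← Real.rpow_add he0]
        congr 1
        push_cast
        ring

end Parameters

section Digits

/-- The fractional part of `a ^ n * v`. -/
noncomputable def fracPow (a : ℕ) (v : ℝ) (n : ℕ) : ℝ := Int.fract (a ^ n * v)

/-- The `n`-th digit of `v` in base `a`. -/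
noncomputable def digit (a : ℕ) (v : ℝ) (n : ℕ) : ℤ := ⌊a * fracPow a v n⌋

variable {a : ℕ} {v : ℝ}

lemma fracPow_succ (n : ℕ) : fracPow a v (n + 1) = a * fracPow a v n - digit a v n := by
  have h : (a : ℝ) ^ (n + 1) * v = a * fracPow a v n + ((a * ⌊(a : ℝ) ^ n * v⌋ : ℤ) : ℝ) := by
    rw [fracPow, Int.fract]
    push_cast
    ring
  rw [fracPow, h, Int.fract_add_intCast, Int.fract, digit]

lemma digit_mem (ha : a ≠ 0) (n : ℕ) : digit a v n ∈ Finset.Ico (0 : ℤ) a := by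
  have ha' : (0 : ℝ) < a := by positivity
  rw [Finset.mem_Ico, digit, Int.floor_nonneg, Int.floor_lt]
  have h0 := Int.fract_nonneg ((a : ℝ) ^ n * v)
  have h1 := Int.fract_lt_one ((a : ℝ) ^ n * v)
  exact ⟨mul_nonneg ha'.le h0, by rw [fracPow]; push_cast; nlinarith⟩

lemma abs_fracPow_sub_le (ha : a ≠ 0) (k : ℕ) : ∀ n n' : ℕ,
    (∀ i < k, digit a v (n + i) = digit a v (n' + i)) →
      |fracPow a v n - fracPow a v n'| ≤ ((a : ℝ) ^ k)⁻¹ := by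
  have ha' : (0 : ℝ) < a := by positivity
  induction k with
  | zero =>
    intro n n' _
    have h0 := Int.fract_nonneg ((a : ℝ) ^ n * v)
    have h1 := Int.fract_lt_one ((a : ℝ) ^ n * v)
    have h2 := Int.fract_nonneg ((a : ℝ) ^ n' * v)
    have h3 := Int.fract_lt_one ((a : ℝ) ^ n' * v)
    rw [pow_zero, inv_one, abs_le, fracPow, fracPow]
    constructor <;> linarith
  | succ k ih =>
    intro n n' h
    have h1 := ih (n + 1) (n' + 1) fun i hi => by
      simpa [add_assoc, add_comm 1] using h (i + 1) (by omega)
    have h2 : digit a v n = digit a v n' := by simpa using h 0 (by omega)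
    rw [fracPow_succ, fracPow_succ, h2, sub_sub_sub_cancel_right, ← mul_sub, abs_mul,
      abs_of_pos ha'] at h1
    rw [pow_succ, mul_inv, ← div_eq_mul_inv, le_div_iff₀ ha']
    linarith

lemma norm_coe_pow_mul_sub_le (ha : a ≠ 0) {k n n' : ℕ}
    (h : ∀ i < k, digit a v (n + i) = digit a v (n' + i)) :
    ‖(((a : ℝ) ^ n * v : ℝ) : UnitAddCircle) - (((a : ℝ) ^ n' * v : ℝ) : UnitAddCircle)‖ ≤
      ((a : ℝ) ^ k)⁻¹ := by
  have hcoe : ∀ m : ℕ, (((a : ℝ) ^ m * v : ℝ) : UnitAddCircle) = (fracPow a v m : UnitAddCircle) :=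
    fun m => by
      rw [fracPow, Int.fract, AddCircle.coe_sub, eq_comm, sub_eq_self, AddCircle.coe_eq_zero_iff]
      exact ⟨⌊(a : ℝ) ^ m * v⌋, by simp⟩
  rw [hcoe, hcoe, ← AddCircle.coe_sub]
  refine le_trans ?_ (abs_fracPow_sub_le ha k n n' h)
  rw [UnitAddCircle.norm_eq]
  simpa using round_le (fracPow a v n - fracPow a v n') 0

end Digits

section Blocks

open Filter Topology

variable {β : Type*} {D : ℕ → β}

/-- The sequence of consecutive blocks of length `L` of the sequence `D`. -/
def blocks (D : ℕ → β) (L : ℕ) : ℕ → range (word D L) :=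
  fun m => ⟨word D L (L * m), mem_range_self _⟩

lemma one_le_wordCount [Finite β] (K : ℕ) {S : Set ℕ} (hS : S.Nonempty) : 1 ≤ wordCount D K S :=
  (ncard_pos (toFinite _)).2 (hS.image _)

lemma wordCount_add_le [Finite β] (m n : ℕ) :
    wordCount D (m + n) univ ≤ wordCount D m univ * wordCount D n univ := by
  have hsub : word D (m + n) '' univ ⊆
      (fun p : (Fin m → β) × (Fin n → β) => Fin.append p.1 p.2) ''
        ((word D m '' univ) ×ˢ (word D n '' univ)) := by
    rintro _ ⟨k, -, rfl⟩
    refine ⟨(word D m k, word D n (k + m)), ⟨⟨k, trivial, rfl⟩, ⟨k + m, trivial, rfl⟩⟩, ?_⟩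
    funext i
    refine Fin.addCases (fun i => ?_) (fun i => ?_) i <;> simp [word, add_assoc]
  exact (ncard_le_ncard hsub (toFinite _)).trans
    ((ncard_image_le (toFinite _)).trans_eq ncard_prod)

lemma wordCount_univ_le [Fintype β] (L : ℕ) : wordCount D L univ ≤ Fintype.card β ^ L := by
  refine (ncard_le_ncard (subset_univ _) (toFinite _)).trans_eq ?_
  rw [ncard_univ, Nat.card_eq_fintype_card, Fintype.card_fun, Fintype.card_fin]

lemma wordCount_mul_le_blocks [Finite β] {L : ℕ} (hL : 0 < L) (K : ℕ) :
    wordCount D (L * K) univ ≤ L * wordCount (blocks D L) (K + 1) univ := by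
  have hlt : ∀ (r : Fin L) (i : Fin (L * K)), ((r : ℕ) + i) / L < K + 1 := fun r i => by
    rw [Nat.div_lt_iff_lt_mul hL]
    have := r.2
    have := i.2
    nlinarith
  have hsub : word D (L * K) '' univ ⊆
      (fun p : Fin L × (Fin (K + 1) → range (word D L)) => fun i : Fin (L * K) =>
        (p.2 ⟨((p.1 : ℕ) + i) / L, hlt p.1 i⟩).1 ⟨((p.1 : ℕ) + i) % L, Nat.mod_lt _ hL⟩) ''
        ((univ : Set (Fin L)) ×ˢ (word (blocks D L) (K + 1) '' univ)) := by
    rintro _ ⟨n, -, rfl⟩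
    refine ⟨(⟨n % L, Nat.mod_lt _ hL⟩, word (blocks D L) (K + 1) (n / L)),
      ⟨trivial, ⟨_, trivial, rfl⟩⟩, ?_⟩
    funext i
    simp only [word, blocks]
    congr 1
    rw [mul_add, add_assoc, Nat.div_add_mod, ← add_assoc, Nat.div_add_mod]
  refine (ncard_le_ncard hsub (toFinite _)).trans
    ((ncard_image_le (toFinite _)).trans_eq ?_)
  rw [ncard_prod, ncard_univ, Nat.card_eq_fintype_card, Fintype.card_fin, wordCount]

lemma subadditive_log_wordCount [Finite β] :
    Subadditive fun n => Real.log (wordCount D n univ) := fun m n => by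
  have hpos : ∀ k, (0 : ℝ) < wordCount D k univ := fun k => by
    exact_mod_cast one_le_wordCount k univ_nonempty
  rw [← Real.log_mul (hpos m).ne' (hpos n).ne']
  exact Real.log_le_log (hpos _) (by exact_mod_cast wordCount_add_le m n)

/-- For large `L`, the number of words in the sequence of blocks of length `L` grows almost as fast
as the number of blocks permits. -/
lemma eventually_blocks_growth [Finite β] {ε : ℝ} (hε : 0 < ε) :
    ∀ᶠ L : ℕ in atTop, ∃ c > 0, ∀ K,
      c * (wordCount D L univ * Real.exp (-(ε * L))) ^ K ≤ wordCount (blocks D L) K univ := by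
  have hone : ∀ k, (1 : ℝ) ≤ wordCount D k univ := fun k => by
    exact_mod_cast one_le_wordCount k univ_nonempty
  have hpos : ∀ k, (0 : ℝ) < wordCount D k univ := fun k => one_pos.trans_le (hone k)
  have hsub := subadditive_log_wordCount (D := D)
  have hbdd : BddBelow (range fun n : ℕ => Real.log (wordCount D n univ) / n) := by
    refine ⟨0, ?_⟩
    rintro _ ⟨n, rfl⟩
    exact div_nonneg (Real.log_nonneg (hone n)) n.cast_nonneg
  have hlow : ∀ K : ℕ, Real.exp (hsub.lim * K) ≤ wordCount D K univ := fun K => by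
    rcases Nat.eq_zero_or_pos K with rfl | hK
    · simpa using hone 0
    · have hK' : (0 : ℝ) < K := by exact_mod_cast hK
      rw [← Real.le_log_iff_exp_le (hpos K), ← le_div_iff₀ hK']
      exact hsub.lim_le_div hbdd hK.ne'
  filter_upwards [(hsub.tendsto_lim hbdd).eventually (gt_mem_nhds (lt_add_of_pos_right _ hε)),
    eventually_gt_atTop 0] with L hL hL0
  have hL' : (0 : ℝ) < L := by exact_mod_cast hL0
  set q : ℝ := wordCount D L univ * Real.exp (-(ε * L)) with hq
  have hq0 : 0 < q := mul_pos (hpos L) (Real.exp_pos _)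
  have hqle : q ≤ Real.exp (hsub.lim * L) := by
    rw [div_lt_iff₀ hL', Real.log_lt_iff_lt_exp (hpos L)] at hL
    rw [hq]
    calc _ ≤ Real.exp ((hsub.lim + ε) * L) * Real.exp (-(ε * L)) := by gcongr
      _ = Real.exp (hsub.lim * L) := by rw [← Real.exp_add]; congr 1; ring
  refine ⟨min 1 (L * q)⁻¹, by positivity, fun K => ?_⟩
  cases K with
  | zero =>
    rw [pow_zero, mul_one]
    refine (min_le_left _ _).trans ?_
    exact_mod_cast one_le_wordCount 0 univ_nonempty
  | succ K =>
    have h1 : q ^ K ≤ L * wordCount (blocks D L) (K + 1) univ := by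
      calc q ^ K ≤ Real.exp (hsub.lim * L) ^ K := by gcongr
        _ = Real.exp (hsub.lim * (L * K : ℕ)) := by
          rw [← Real.exp_nat_mul]; congr 1; push_cast; ring
        _ ≤ wordCount D (L * K) univ := hlow _
        _ ≤ _ := by exact_mod_cast wordCount_mul_le_blocks hL0 K
    calc min 1 (L * q)⁻¹ * q ^ (K + 1) ≤ (L * q)⁻¹ * q ^ (K + 1) := by
          gcongr; exact min_le_right _ _
      _ = q ^ K / L := by rw [pow_succ]; field_simp
      _ ≤ _ := by rw [div_le_iff₀ hL']; linarith

end Blocks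

section Main

open Filter Topology

/-- The digits of `v` in base `a`, as elements of a finite type. -/
noncomputable def digitSeq {a : ℕ} (ha : a ≠ 0) (v : ℝ) (n : ℕ) : Finset.Ico (0 : ℤ) a :=
  ⟨digit a v n, digit_mem ha n⟩

lemma norm_coe_pow_mul_sub_le_of_blocks {a : ℕ} (ha : a ≠ 0) {v : ℝ} {L : ℕ} (hL : 0 < L)
    {k n n' : ℕ}
    (h : ∀ i < k, blocks (digitSeq ha v) L (n + i) = blocks (digitSeq ha v) L (n' + i)) :
    ‖(((a : ℝ) ^ (L * n) * v : ℝ) : UnitAddCircle) -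
        (((a : ℝ) ^ (L * n') * v : ℝ) : UnitAddCircle)‖ ≤ (((a : ℝ) ^ L) ^ k)⁻¹ := by
  rw [← pow_mul]
  refine norm_coe_pow_mul_sub_le ha fun j hj => ?_
  have hidx : ∀ m, L * (m + j / L) + j % L = L * m + j := fun m => by
    rw [mul_add, add_assoc, Nat.div_add_mod]
  have h1 := congrFun (congrArg Subtype.val (h (j / L) (Nat.div_lt_of_lt_mul hj)))
    ⟨j % L, Nat.mod_lt _ hL⟩
  simp only [blocks, word, hidx] at h1
  exact congrArg Subtype.val h1

lemma exists_exponent {s : ℝ} (hs : s < 1) :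
    ∃ J : ℕ, J ≠ 0 ∧ 5 * J + 6 ≤ (J : ℝ) ^ 2 * (1 - s) := by
  obtain ⟨J, hJ⟩ := exists_nat_ge (max 1 (11 / (1 - s)))
  have h1 : (1 : ℝ) ≤ J := (le_max_left _ _).trans hJ
  have h2 : 11 / (1 - s) ≤ J := (le_max_right _ _).trans hJ
  rw [div_le_iff₀ (by linarith)] at h2
  refine ⟨J, ?_, by nlinarith⟩
  rintro rfl
  norm_num at h1

theorem le_dimH_closure {u : ℝ} (hu : Irrational u) {a : ℕ} (ha : 2 ≤ a) (v : ℝ) :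
    1 ≤ dimH (closure {x : AddCircle (1 : ℝ) |
      ∃ n : ℕ, x = ((n * u + a ^ n * v : ℝ) : AddCircle (1 : ℝ))}) := by
  by_contra! hlt
  obtain ⟨s, hXs, hs1⟩ := ENNReal.lt_iff_exists_nnreal_btwn.1 hlt
  set X := closure {x : AddCircle (1 : ℝ) |
    ∃ n : ℕ, x = ((n * u + a ^ n * v : ℝ) : AddCircle (1 : ℝ))} with hX
  have hs0 : (0 : ℝ) < s := by
    have := (zero_le (a := dimH X)).trans_lt hXs
    exact_mod_cast this
  have hs1' : (s : ℝ) < 1 := by exact_mod_cast hs1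
  have ha0 : a ≠ 0 := by omega
  have ha1 : (1 : ℝ) < a := by exact_mod_cast (by omega : 1 < a)
  have haR : (0 : ℝ) < a := one_pos.trans ha1
  obtain ⟨J, hJ0, hJ⟩ := exists_exponent hs1'
  have hJ0' : (J : ℝ) ≠ 0 := Nat.cast_ne_zero.2 hJ0
  have hJJ : 0 < J * J := by positivity
  have hε : 0 < Real.log a / (J * J) := by
    have := Real.log_pos ha1
    positivity
  have hmul : Tendsto (fun M : ℕ => J * J * M) atTop atTop :=
    tendsto_id.const_mul_atTop' hJJ
  have hpow : Tendsto (fun M : ℕ => (a : ℝ) ^ M) atTop atTop :=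
    tendsto_pow_atTop_atTop_of_one_lt ha1
  obtain ⟨M, ⟨c, hc, hgrowth⟩, he4, heJ, hM⟩ :=
    ((hmul.eventually (eventually_blocks_growth (D := digitSeq ha0 v) hε)).and
      ((hpow.eventually_ge_atTop 4).and ((hpow.eventually_ge_atTop ((J : ℝ) ^ 2)).and
        (eventually_gt_atTop 0)))).exists
  set L := J * J * M with hL
  have hL0 : 0 < L := by positivity
  set e : ℝ := (a : ℝ) ^ M with he
  have heL : e ^ (J * J) = (a : ℝ) ^ L := by rw [he, ← pow_mul, hL, mul_comm M]
  obtain ⟨r, hr1, hr2⟩ := exists_steps hJ he4 heJ rfl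
  have hE1 : 1 < e ^ (J * J) := one_lt_pow₀ (by linarith) hJJ.ne'
  have hE0 : 0 < e ^ (J * J) := one_pos.trans hE1
  obtain ⟨T, x, k, hcover, hsum⟩ := exists_finite_cover_of_hausdorffMeasure_eq_zero
    (isClosed_closure.isCompact : IsCompact X) hs0 (hausdorffMeasure_of_dimH_lt hXs)
    (inv_pos.2 hE0) (inv_lt_one_of_one_lt₀ hE1) (η := (192 * e ^ (J * J))⁻¹) (by positivity)
  let _ : Fintype (range (word (digitSeq ha0 v) L)) := Fintype.ofFinite _
  have : Nonempty (range (word (digitSeq ha0 v) L)) := ⟨⟨_, mem_range_self 0⟩⟩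
  have hcard : Fintype.card (range (word (digitSeq ha0 v) L)) =
      wordCount (digitSeq ha0 v) L univ := by
    rw [← Nat.card_eq_fintype_card, Nat.card_coe_set_eq, wordCount, image_univ]
  have hexp : Real.exp (-(Real.log a / (J * J) * L)) = e⁻¹ := by
    rw [Real.exp_neg, he, ← Real.exp_log (pow_pos haR M), Real.log_pow, hL]
    push_cast
    congr 2
    field_simp
  have hrot : DenseRange fun z : ℤ => z • (((L * u : ℝ)) : UnitAddCircle) := by
    refine AddCircle.denseRange_zsmul_coe_iff.2 ?_
    rw [div_one]
    exact hu.natCast_mul hL0.ne'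
  have hmain := one_le_cover_sum (d := blocks (digitSeq ha0 v) L) hrot
    (y := fun m => (((a : ℝ) ^ (L * m) * v : ℝ) : UnitAddCircle)) hJ0 he4 rfl
    (by
      rw [hcard, heL]
      have h1 := wordCount_univ_le (D := digitSeq ha0 v) L
      rw [Fintype.card_coe, Int.card_Ico, sub_zero, Int.toNat_natCast] at h1
      exact_mod_cast h1)
    hc (by rw [hcard, div_eq_mul_inv, ← hexp]; exact hgrowth) hr1
    (fun k n n' h => by rw [heL]; exact norm_coe_pow_mul_sub_le_of_blocks ha0 hL0 h)
    T x k
    (fun n => by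
      obtain ⟨i, hi, hdist⟩ := hcover (((L * n : ℕ) * u + a ^ (L * n) * v : ℝ) : AddCircle (1 : ℝ))
        (subset_closure ⟨L * n, rfl⟩)
      refine ⟨i, hi, ?_⟩
      rw [← inv_pow]
      convert hdist using 1
      rw [dist_eq_norm, AddCircle.coe_add, ← AddCircle.coe_nsmul, nsmul_eq_mul]
      congr 4
      push_cast
      ring)
  have hle : ∑ i ∈ T, ((e ^ J) ^ 2 * (r + 1) / e ^ (J * J)) ^ k i ≤
      ∑ i ∈ T, (((e ^ (J * J))⁻¹) ^ k i) ^ (s : ℝ) := by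
    refine Finset.sum_le_sum fun i _ => ?_
    rw [← Real.rpow_pow_comm (by positivity)]
    gcongr
  have hlt1 : 192 * e ^ (J * J) * ∑ i ∈ T, ((e ^ J) ^ 2 * (r + 1) / e ^ (J * J)) ^ k i < 1 := by
    rw [← lt_inv_mul_iff₀ (by positivity), mul_one]
    exact hle.trans_lt hsum
  exact hmain.not_gt hlt1

theorem dimH_addCircle_le (A : Set (AddCircle (1 : ℝ))) : dimH A ≤ 1 := by
  have hlip : LipschitzWith 1 (fun x : ℝ => (x : AddCircle (1 : ℝ))) :=
    LipschitzWith.of_dist_le_mul fun x y => by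
      rw [dist_eq_norm, ← AddCircle.coe_sub, UnitAddCircle.norm_eq, NNReal.coe_one, one_mul,
        Real.dist_eq]
      simpa using round_le (x - y) 0
  calc dimH A ≤ dimH (range fun x : ℝ => (x : AddCircle (1 : ℝ))) :=
        dimH_mono fun x _ => QuotientAddGroup.mk_surjective x
    _ ≤ dimH (univ : Set ℝ) := hlip.dimH_range_le
    _ = 1 := Real.dimH_univ

end Main

end RotationPower

/-- **Yu's theorem.** For irrational `u`, an integer `a ≥ 2` and arbitrary `v`,
the closure in the circle `𝕋 = ℝ/ℤ` of `{n u + a^n v : n ∈ ℕ}` has Hausdorff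
dimension `1`. -/
theorem yu_theorem (u : ℝ) (hu : Irrational u) (a : ℕ) (ha : 2 ≤ a) (v : ℝ) :
    dimH (closure {x : AddCircle (1 : ℝ) |
      ∃ n : ℕ, x = ((n * u + a ^ n * v : ℝ) : AddCircle (1 : ℝ))}) = 1 := by
  exact le_antisymm (RotationPower.dimH_addCircle_le _) (RotationPower.le_dimH_closure hu ha v)
end

section
/- Let u ∈ ℝ be irrational and let a ≥ 2 be an integer. Let C ⊆ 𝕋 × 𝕋 be nonempty, closed, and forward invariant under R_u × S_a, i.e. (x,y) ∈ C implies (x + u, a·y) ∈ C, where x + u is rotation by u mod 1 and a·y is multiplication by a on 𝕋 = ℝ/ℤ. Let σ : 𝕋 × 𝕋 → 𝕋 be the map σ(x,y) = x + y. Then dimH(σ[C]) = 1. -/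
open MeasureTheory Set

lemma coe_eq_coe_fract (v : ℝ) : (v : UnitAddCircle) = (Int.fract v : ℝ) := by
  rw [eq_comm, ← sub_eq_zero, ← AddCircle.coe_sub, AddCircle.coe_eq_zero_iff]
  exact ⟨-⌊v⌋, by rw [← Int.self_sub_floor]; simp⟩

lemma dist_coe_le (x y : ℝ) : dist (x : UnitAddCircle) y ≤ dist x y := by
  rw [dist_eq_norm, ← AddCircle.coe_sub, dist_eq_norm]
  exact QuotientAddGroup.norm_mk_le_norm

/-- The index of the `a`-adic interval of order `n` containing `y`. -/
noncomputable def adicIndex (a n : ℕ) (y : UnitAddCircle) : ℕ :=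
  ⌊(a : ℝ) ^ n * (AddCircle.equivIco 1 0 y : ℝ)⌋₊

lemma adicIndex_coe (a n : ℕ) (v : ℝ) :
    adicIndex a n (v : UnitAddCircle) = ⌊(a : ℝ) ^ n * Int.fract v⌋₊ := by
  have h := AddCircle.coe_equivIco_mk_apply (p := (1 : ℝ)) v
  simp only [div_one, mul_one] at h
  rw [adicIndex, ← h]

lemma adicIndex_lt {a : ℕ} (ha : 0 < a) (n : ℕ) (y : UnitAddCircle) : adicIndex a n y < a ^ n := by
  induction y using QuotientAddGroup.induction_on with
  | H v =>
    have : (0 : ℝ) < (a : ℝ) ^ n := by positivity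
    rw [adicIndex_coe, Nat.floor_lt (by positivity)]
    push_cast
    nlinarith [Int.fract_lt_one v]

lemma adicIndex_add (a n m : ℕ) (y : UnitAddCircle) :
    adicIndex a (n + m) y = a ^ m * adicIndex a n y + adicIndex a m (a ^ n • y) := by
  induction y using QuotientAddGroup.induction_on with
  | H v =>
    have hw : (a ^ n • (v : UnitAddCircle)) =
        (((a : ℝ) ^ n * Int.fract v : ℝ) : UnitAddCircle) := by
      rw [coe_eq_coe_fract v, ← AddCircle.coe_nsmul, nsmul_eq_mul, Nat.cast_pow]
    change adicIndex a (n + m) (v : UnitAddCircle) =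
      a ^ m * adicIndex a n (v : UnitAddCircle) + adicIndex a m (a ^ n • (v : UnitAddCircle))
    rw [hw]
    simp only [adicIndex_coe]
    set w : ℝ := (a : ℝ) ^ n * Int.fract v with hwdef
    have hw0 : 0 ≤ w := by positivity
    have hfr : w = ⌊w⌋₊ + Int.fract w := by
      rw [natCast_floor_eq_intCast_floor hw0, Int.floor_add_fract]
    have : (a : ℝ) ^ (n + m) * Int.fract v = (a : ℝ) ^ m * Int.fract w + (a ^ m * ⌊w⌋₊ : ℕ) := by
      push_cast
      rw [pow_add, mul_right_comm, ← hwdef]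
      linear_combination (a : ℝ) ^ m * hfr
    rw [this, Nat.floor_add_natCast (by positivity), add_comm]

lemma dist_le_of_adicIndex_eq {a : ℕ} (ha : 0 < a) (n : ℕ) {y y' : UnitAddCircle}
    (h : adicIndex a n y = adicIndex a n y') : dist y y' ≤ (a : ℝ)⁻¹ ^ n := by
  induction y using QuotientAddGroup.induction_on with
  | H v =>
  induction y' using QuotientAddGroup.induction_on with
  | H v' =>
    change adicIndex a n (v : UnitAddCircle) = adicIndex a n (v' : UnitAddCircle) at h
    change dist (v : UnitAddCircle) (v' : UnitAddCircle) ≤ _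
    have hpos : (0 : ℝ) < (a : ℝ) ^ n := by positivity
    rw [coe_eq_coe_fract v, coe_eq_coe_fract v']
    refine (dist_coe_le _ _).trans ?_
    rw [adicIndex_coe, adicIndex_coe] at h
    have h1 := Nat.floor_le (a := (a : ℝ) ^ n * Int.fract v) (by positivity)
    have h2 := Nat.lt_floor_add_one ((a : ℝ) ^ n * Int.fract v)
    have h3 := Nat.floor_le (a := (a : ℝ) ^ n * Int.fract v') (by positivity)
    have h4 := Nat.lt_floor_add_one ((a : ℝ) ^ n * Int.fract v')
    rw [h] at h1 h2
    rw [inv_pow, ← one_div, le_div_iff₀ hpos, Real.dist_eq, ← abs_of_pos hpos, ← abs_mul,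
      abs_le]
    constructor <;> nlinarith

open Classical in
/-- The indices of the `a`-adic intervals of order `n` that meet `S`. -/
noncomputable def adicIndices (a n : ℕ) (S : Set UnitAddCircle) : Finset ℕ :=
  (Finset.range (a ^ n)).filter fun q => ∃ y ∈ S, adicIndex a n y = q

lemma mem_adicIndices {a : ℕ} (ha : 0 < a) {n : ℕ} {S : Set UnitAddCircle} {q : ℕ} :
    q ∈ adicIndices a n S ↔ ∃ y ∈ S, adicIndex a n y = q := by
  simp only [adicIndices, Finset.mem_filter, Finset.mem_range, and_iff_right_iff_imp]
  rintro ⟨y, -, rfl⟩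
  exact adicIndex_lt ha n y

lemma card_adicIndices_le (a n : ℕ) (S : Set UnitAddCircle) : (adicIndices a n S).card ≤ a ^ n := by
  classical
  exact (Finset.card_filter_le _ _).trans (by simp)

lemma card_adicIndices_le_sum {a : ℕ} (ha : 0 < a) {n : ℕ} {S : Set UnitAddCircle} {J : Type*}
    (F : Finset J) (k q : J → ℕ) (S' : J → Set UnitAddCircle) (hk : ∀ j ∈ F, k j ≤ n)
    (h : ∀ y ∈ S, ∃ j ∈ F, adicIndex a (k j) y = q j ∧ a ^ k j • y ∈ S' j) :
    (adicIndices a n S).card ≤ ∑ j ∈ F, (adicIndices a (n - k j) (S' j)).card := by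
  classical
  calc (adicIndices a n S).card
      ≤ (F.biUnion fun j => (adicIndices a (n - k j) (S' j)).image
          fun p => a ^ (n - k j) * q j + p).card := by
        apply Finset.card_le_card
        intro p hp
        obtain ⟨y, hy, rfl⟩ := (mem_adicIndices ha).1 hp
        obtain ⟨j, hj, hq, hyj⟩ := h y hy
        simp only [Finset.mem_biUnion, Finset.mem_image]
        refine ⟨j, hj, adicIndex a (n - k j) (a ^ k j • y), (mem_adicIndices ha).2 ⟨_, hyj, rfl⟩, ?_⟩
        rw [← hq, ← adicIndex_add, Nat.add_sub_cancel' (hk j hj)]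
    _ ≤ _ := Finset.card_biUnion_le.trans (Finset.sum_le_sum fun _ _ => Finset.card_image_le)

lemma exists_dist_nsmul_lt {u : ℝ} (hu : Irrational u) {r : ℝ} (hr : 0 < r) :
    ∃ M : ℕ, ∀ z x : UnitAddCircle, ∃ m < M, dist x (z + m • (u : UnitAddCircle)) < r := by
  have hd : DenseRange fun n : ℕ => n • (u : UnitAddCircle) := by
    rw [← denseRange_zsmul_iff_nsmul, AddCircle.denseRange_zsmul_coe_iff]
    simpa using hu
  obtain ⟨F, hF⟩ := isCompact_univ.elim_finite_subcover
    (fun n : ℕ => Metric.ball (n • (u : UnitAddCircle)) r) (fun _ => Metric.isOpen_ball)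
    (fun x _ => by
      obtain ⟨n, hn⟩ := hd.exists_dist_lt x hr
      exact mem_iUnion.2 ⟨n, hn⟩)
  refine ⟨F.sup id + 1, fun z x => ?_⟩
  obtain ⟨n, hn, hx⟩ := mem_iUnion₂.1 (hF (mem_univ (x - z)))
  refine ⟨n, Nat.lt_succ_of_le (Finset.le_sup (f := id) hn), ?_⟩
  rw [Metric.mem_ball] at hx
  rwa [add_comm z, dist_eq_norm, ← sub_sub, sub_right_comm, ← dist_eq_norm]

lemma dimH_univ_unitAddCircle_le : dimH (univ : Set UnitAddCircle) ≤ 1 := by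
  have hL : LipschitzWith 1 (fun x : ℝ => (x : UnitAddCircle)) :=
    LipschitzWith.of_dist_le_mul fun x y => by
      simpa using dist_coe_le x y
  have := hL.dimH_range_le
  rwa [(QuotientAddGroup.mk_surjective).range_eq, Real.dimH_univ] at this

lemma exists_pow_ball_cover {X : Type*} [MetricSpace X] [Nonempty X] {b s : ℝ} (hb : 1 < b)
    (hs : 0 < s) {t : Set X} (ht : Metric.ediam t ≤ ENNReal.ofReal (b⁻¹ ^ 3)) {ε : ENNReal}
    (hε : 0 < ε) :
    ∃ (z : X) (k : ℕ), 1 ≤ k ∧ t ⊆ Metric.ball z (b⁻¹ ^ k) ∧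
      ENNReal.ofReal (b ^ (-s * k)) ≤
        ENNReal.ofReal (b ^ (2 * s)) * (⨆ _ : t.Nonempty, Metric.ediam t ^ s) + ε := by
  have hb0 : 0 < b := by linarith
  have hlim : ∃ k : ℕ, 1 ≤ k ∧ ENNReal.ofReal (b ^ (-s * k)) ≤ ε := by
    have h1 : Filter.Tendsto (fun k : ℕ => (b ^ (-s)) ^ k) Filter.atTop (nhds 0) :=
      tendsto_pow_atTop_nhds_zero_of_lt_one (by positivity)
        (Real.rpow_lt_one_of_one_lt_of_neg hb (by linarith))
    have h2 := ENNReal.tendsto_ofReal h1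
    rw [ENNReal.ofReal_zero] at h2
    obtain ⟨k, hk, hk1⟩ :=
      ((h2.eventually_le_const hε).and (Filter.eventually_ge_atTop 1)).exists
    exact ⟨k, hk1, by rwa [Real.rpow_mul_natCast hb0.le]⟩
  rcases t.eq_empty_or_nonempty with rfl | ⟨z, hz⟩
  · obtain ⟨k, hk, hkε⟩ := hlim
    exact ⟨Classical.arbitrary X, k, hk, empty_subset _, hkε.trans le_add_self⟩
  have hfin : Metric.ediam t ≠ ⊤ := ne_top_of_le_ne_top ENNReal.ofReal_ne_top ht
  have hbdd : Bornology.IsBounded t := Metric.isBounded_iff_ediam_ne_top.2 hfin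
  have hdist : ∀ x ∈ t, dist x z ≤ Metric.diam t := fun x hx => Metric.dist_le_diam_of_mem hbdd hx hz
  have hd3 : Metric.diam t ≤ b⁻¹ ^ 3 := ENNReal.toReal_le_of_le_ofReal (by positivity) ht
  rcases Metric.diam_nonneg (s := t) |>.eq_or_lt with h0 | hpos
  · obtain ⟨k, hk, hkε⟩ := hlim
    refine ⟨z, k, hk, fun x hx => ?_, hkε.trans le_add_self⟩
    rw [Metric.mem_ball]
    exact (hdist x hx).trans_lt (h0 ▸ by positivity)
  have hb1 : b⁻¹ < 1 := inv_lt_one_of_one_lt₀ hb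
  have hbi : 0 < b⁻¹ := by positivity
  obtain ⟨n, hn, hn'⟩ := exists_nat_pow_near_of_lt_one hpos
    (hd3.trans (pow_le_one₀ hbi.le hb1.le)) hbi hb1
  have hn3 : 3 < n + 1 := (pow_lt_pow_iff_right_of_lt_one₀ hbi hb1).1 (hn.trans_le hd3)
  obtain ⟨k, rfl⟩ : ∃ k, n = k + 1 := ⟨n - 1, by omega⟩
  refine ⟨z, k, by omega, fun x hx => ?_, ?_⟩
  · rw [Metric.mem_ball]
    exact ((hdist x hx).trans hn').trans_lt
      ((pow_lt_pow_iff_right_of_lt_one₀ hbi hb1).2 k.lt_succ_self)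
  · rw [iSup_pos ⟨z, hz⟩, ← ENNReal.ofReal_toReal hfin, ← Metric.diam,
      ENNReal.ofReal_rpow_of_pos hpos, ← ENNReal.ofReal_mul (by positivity)]
    refine le_add_right (ENNReal.ofReal_le_ofReal ?_)
    calc b ^ (-s * k) = b ^ (2 * s) * (b⁻¹ ^ (k + 1 + 1)) ^ s := by
          rw [← Real.rpow_natCast, ← Real.rpow_mul hbi.le, Real.inv_rpow hb0.le,
            ← Real.rpow_neg hb0.le, ← Real.rpow_add hb0]
          congr 1
          push_cast
          ring
      _ ≤ _ := by gcongr

lemma exists_finite_ball_cover {X : Type*} [MetricSpace X] [Nonempty X] [MeasurableSpace X]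
    [BorelSpace X] {A : Set X} (hA : IsCompact A) {b s η : ℝ} (hb : 1 < b) (hs : 0 < s)
    (h0 : Measure.hausdorffMeasure s A = 0) (hη : 0 < η) :
    ∃ (ι : Finset ℕ) (z : ℕ → X) (k : ℕ → ℕ), (∀ i, 1 ≤ k i) ∧
      A ⊆ ⋃ i ∈ ι, Metric.ball (z i) (b⁻¹ ^ k i) ∧ ∑ i ∈ ι, b ^ (-s * k i) ≤ η := by
  have hb0 : 0 < b := by linarith
  set η' := ENNReal.ofReal (η / 2) with hη'
  have hη'0 : 0 < η' := by simpa [hη'] using hη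
  set B := ENNReal.ofReal (b ^ (2 * s)) with hB
  have hB0 : B ≠ 0 := by simp [hB]; positivity
  have hr : 0 < ENNReal.ofReal (b⁻¹ ^ 3) := by simp only [ENNReal.ofReal_pos]; positivity
  rw [Measure.hausdorffMeasure_apply] at h0
  have h1 : (⨅ (t : ℕ → Set X) (_ : A ⊆ ⋃ n, t n)
      (_ : ∀ n, Metric.ediam (t n) ≤ ENNReal.ofReal (b⁻¹ ^ 3)),
      ∑' n, ⨆ _ : (t n).Nonempty, Metric.ediam (t n) ^ s) < η' / B := by
    refine lt_of_le_of_lt ?_ (ENNReal.div_pos hη'0.ne' ENNReal.ofReal_ne_top)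
    rw [← h0]
    exact le_iSup₂ (α := ENNReal) (f := fun r (_ : 0 < r) => ⨅ (t : ℕ → Set X) (_ : A ⊆ ⋃ n, t n)
      (_ : ∀ n, Metric.ediam (t n) ≤ r), ∑' n, ⨆ _ : (t n).Nonempty, Metric.ediam (t n) ^ s) _ hr
  simp only [iInf_lt_iff] at h1
  obtain ⟨t, htA, htd, hts⟩ := h1
  obtain ⟨ε, hε, hεs⟩ := ENNReal.exists_pos_sum_of_countable' hη'0.ne' ℕ
  choose z k hk hsub hle using fun i => exists_pow_ball_cover hb hs (htd i) (hε i)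
  obtain ⟨ι, hι⟩ := hA.elim_finite_subcover (fun i => Metric.ball (z i) (b⁻¹ ^ k i))
    (fun _ => Metric.isOpen_ball) (htA.trans (iUnion_mono hsub))
  refine ⟨ι, z, k, hk, hι, ?_⟩
  rw [← ENNReal.ofReal_le_ofReal_iff hη.le, ENNReal.ofReal_sum_of_nonneg fun _ _ => by positivity]
  calc ∑ i ∈ ι, ENNReal.ofReal (b ^ (-s * k i))
      ≤ ∑' i, (B * (⨆ _ : (t i).Nonempty, Metric.ediam (t i) ^ s) + ε i) :=
        (Finset.sum_le_sum fun i _ => hle i).trans (ENNReal.sum_le_tsum ι)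
    _ = B * (∑' i, ⨆ _ : (t i).Nonempty, Metric.ediam (t i) ^ s) + ∑' i, ε i := by
        rw [ENNReal.tsum_add, ENNReal.tsum_mul_left]
    _ ≤ B * (η' / B) + η' := by gcongr
    _ = ENNReal.ofReal η := by
        rw [ENNReal.mul_div_cancel hB0 ENNReal.ofReal_ne_top, hη',
          ← ENNReal.ofReal_add (by positivity) (by positivity), add_halves]

lemma indicator_one_nonneg {X : Type*} (B : Set X) (x : X) :
    (0 : ℝ) ≤ B.indicator (fun _ => (1 : ℝ)) x :=
  indicator_nonneg (fun _ _ => zero_le_one) x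

lemma birkhoffSum_iterate_le {X : Type*} (f : X → X) {g : X → ℝ} (hg : ∀ x, 0 ≤ g x)
    {k m n : ℕ} (h : k + m ≤ n) (x : X) :
    birkhoffSum f g m (f^[k] x) ≤ birkhoffSum f g n x := by
  obtain ⟨l, rfl⟩ := Nat.exists_eq_add_of_le h
  rw [birkhoffSum_add, birkhoffSum_add]
  have h1 : 0 ≤ birkhoffSum f g k x := Finset.sum_nonneg fun _ _ => hg _
  have h2 : 0 ≤ birkhoffSum f g l (f^[k + m] x) := Finset.sum_nonneg fun _ _ => hg _
  linarith

lemma exists_birkhoffSum_indicator_le {X : Type*} [MeasurableSpace X] {μ : Measure X}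
    [IsProbabilityMeasure μ] {f : X → X} (hf : MeasurePreserving f μ μ) {B : Set X}
    (hB : MeasurableSet B) (n : ℕ) :
    ∃ x, birkhoffSum f (B.indicator fun _ => (1 : ℝ)) n x ≤ n * μ.real B := by
  have hint : ∀ i : ℕ, Integrable (fun x => B.indicator (fun _ => (1 : ℝ)) (f^[i] x)) μ := fun i =>
    (hf.iterate i).integrable_comp_of_integrable ((integrable_const 1).indicator hB)
  obtain ⟨x, hx⟩ := exists_le_integral (μ := μ) (integrable_finsetSum (Finset.range n)
    fun i _ => hint i)
  refine ⟨x, hx.trans_eq ?_⟩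
  rw [integral_finsetSum _ fun i _ => hint i]
  have : ∀ i ∈ Finset.range n, ∫ x, B.indicator (fun _ => (1 : ℝ)) (f^[i] x) ∂μ = μ.real B := by
    intro i _
    have hpre : (fun x => B.indicator (fun _ => (1 : ℝ)) (f^[i] x)) =
        (f^[i] ⁻¹' B).indicator fun _ => (1 : ℝ) := rfl
    rw [hpre, integral_indicator_const _ ((hf.iterate i).measurable hB),
      (hf.iterate i).measureReal_preimage hB.nullMeasurableSet, smul_eq_mul, mul_one]
  rw [Finset.sum_congr rfl this]
  simp

open Classical in
/-- If away from `{x | 1 ≤ ∑ j with x ∈ E j, b ^ (-t * k j)}` the counts `P n x` are controlled by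
those of the shorter words `n - k j`, then they grow at most like `b ^ (t * n)`, up to a factor
accounting for the visits to this exceptional set. -/
lemma count_le_rpow_birkhoffSum {X J : Type*} (f : X → X) (P : ℕ → X → ℝ) {b t : ℝ}
    (hb : 1 < b) (F : Finset J) (k : J → ℕ) (hk : ∀ j, 1 ≤ k j) (E : J → Set X)
    (htriv : ∀ n x, P n x ≤ b ^ n) (hstep : ∀ n x, P (n + 1) x ≤ b * P n (f x))
    (hcover : ∀ n x, (∀ j ∈ F, k j ≤ n) →
      P n x ≤ ∑ j ∈ F with x ∈ E j, P (n - k j) (f^[k j] x)) (ht : t ≤ 1) :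
    ∃ K : ℝ, 0 ≤ K ∧ ∀ n x, P n x ≤ K * b ^ (t * n) * b ^ ((1 - t) * birkhoffSum f
      ({x | 1 ≤ ∑ j ∈ F with x ∈ E j, b ^ (-t * k j)}.indicator fun _ => (1 : ℝ)) n x) := by
  have hb0 : 0 < b := by linarith
  set B := {x | 1 ≤ ∑ j ∈ F with x ∈ E j, b ^ (-t * k j)}
  set g : X → ℝ := B.indicator fun _ => (1 : ℝ)
  have hg0 : ∀ x, 0 ≤ g x := indicator_one_nonneg B
  set N := F.sup k
  refine ⟨b ^ ((1 - t) * N), by positivity, fun n => ?_⟩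
  induction n using Nat.strong_induction_on with
  | _ n ih =>
    intro x
    have hsum0 : 0 ≤ birkhoffSum f g n x := Finset.sum_nonneg fun _ _ => hg0 _
    by_cases hn : n ≤ N
    · refine (htriv n x).trans ?_
      have hn' : (n : ℝ) ≤ N := by exact_mod_cast hn
      rw [← Real.rpow_natCast, ← Real.rpow_add hb0, ← Real.rpow_add hb0]
      apply Real.rpow_le_rpow_of_exponent_le hb.le
      nlinarith [mul_nonneg (sub_nonneg.2 ht) hsum0, mul_nonneg (sub_nonneg.2 ht) (sub_nonneg.2 hn')]
    push Not at hn
    by_cases hx : x ∈ B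
    · obtain ⟨m, rfl⟩ : ∃ m, n = m + 1 := ⟨n - 1, by omega⟩
      have hgx : g x = 1 := indicator_of_mem hx _
      calc P (m + 1) x ≤ b * P m (f x) := hstep m x
        _ ≤ b * (b ^ ((1 - t) * N) * b ^ (t * m) * b ^ ((1 - t) * birkhoffSum f g m (f x))) := by
          gcongr
          exact ih m (Nat.lt_succ_self m) (f x)
        _ = _ := by
          rw [birkhoffSum_succ', hgx]
          nth_rewrite 1 [← Real.rpow_one b]
          simp only [← Real.rpow_add hb0]
          congr 1
          push_cast
          ring
    · have hx' : ∑ j ∈ F with x ∈ E j, b ^ (-t * k j) ≤ 1 := (not_le.1 hx).le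
      have hkn : ∀ j ∈ F, k j ≤ n := fun j hj => (Finset.le_sup hj).trans hn.le
      set R := b ^ ((1 - t) * N) * b ^ (t * n) * b ^ ((1 - t) * birkhoffSum f g n x)
      calc P n x ≤ ∑ j ∈ F with x ∈ E j, P (n - k j) (f^[k j] x) := hcover n x hkn
        _ ≤ ∑ j ∈ F with x ∈ E j, b ^ (-t * k j) * R := by
          refine Finset.sum_le_sum fun j hj => ?_
          have hjn := hkn j (Finset.mem_filter.1 hj).1
          refine (ih (n - k j) (by have := hk j; omega) _).trans ?_
          have h1 : birkhoffSum f g (n - k j) (f^[k j] x) ≤ birkhoffSum f g n x :=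
            birkhoffSum_iterate_le f hg0 (by omega) x
          have h2 : b ^ (t * ((n - k j : ℕ) : ℝ)) = b ^ (-t * k j) * b ^ (t * n) := by
            rw [← Real.rpow_add hb0, Nat.cast_sub hjn]
            ring_nf
          rw [h2]
          calc _ ≤ b ^ ((1 - t) * N) * (b ^ (-t * k j) * b ^ (t * n)) *
                b ^ ((1 - t) * birkhoffSum f g n x) := by
                gcongr
                linarith
            _ = _ := by ring
        _ = (∑ j ∈ F with x ∈ E j, b ^ (-t * k j)) * R := by rw [Finset.sum_mul]
        _ ≤ R := mul_le_of_le_one_left (by positivity) hx'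

/-- The points `y` lying over some point of the ball of radius `r` around `c`. -/
def nearFiber (C : Set (UnitAddCircle × UnitAddCircle)) (r : ℝ) (c : UnitAddCircle) :
    Set UnitAddCircle :=
  {y | ∃ x, (x, y) ∈ C ∧ dist x c < r}

lemma iterate_mem {u : UnitAddCircle} {a : ℕ} {C : Set (UnitAddCircle × UnitAddCircle)}
    (hinv : ∀ p ∈ C, (p.1 + u, a • p.2) ∈ C) (k : ℕ) {x y : UnitAddCircle} (h : (x, y) ∈ C) :
    (x + k • u, a ^ k • y) ∈ C := by
  induction k with
  | zero => simpa using h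
  | succ k ih =>
    have := hinv _ ih
    rwa [add_assoc, ← succ_nsmul, ← mul_nsmul, ← pow_succ] at this

lemma nsmul_mem_nearFiber {u : UnitAddCircle} {a : ℕ} {C : Set (UnitAddCircle × UnitAddCircle)}
    (hinv : ∀ p ∈ C, (p.1 + u, a • p.2) ∈ C) {r : ℝ} (k : ℕ) {c y : UnitAddCircle}
    (h : y ∈ nearFiber C r c) : a ^ k • y ∈ nearFiber C r (c + k • u) := by
  obtain ⟨x, hx, hr⟩ := h
  exact ⟨x + k • u, iterate_mem hinv k hx, by simpa using hr⟩

/-- The translations `c` moving some point of an `a`-adic interval of order `n` into `U`. -/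
def hittingSet (a n q : ℕ) (U : Set UnitAddCircle) : Set UnitAddCircle :=
  {c | ∃ y, adicIndex a n y = q ∧ c + y ∈ U}

lemma isOpen_hittingSet (a n q : ℕ) {U : Set UnitAddCircle} (hU : IsOpen U) :
    IsOpen (hittingSet a n q U) := by
  have : hittingSet a n q U = ⋃ y ∈ {y | adicIndex a n y = q}, (fun c => c + y) ⁻¹' U := by
    ext c
    simp [hittingSet]
  rw [this]
  exact isOpen_biUnion fun y _ => hU.preimage (continuous_add_const y)

lemma volume_real_hittingSet_ball_le {a : ℕ} (ha : 0 < a) (n q : ℕ) (z : UnitAddCircle) :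
    volume.real (hittingSet a n q (Metric.ball z ((a : ℝ)⁻¹ ^ n))) ≤ 6 * (a : ℝ)⁻¹ ^ n := by
  set ρ := (a : ℝ)⁻¹ ^ n
  have hρ0 : 0 ≤ ρ := by positivity
  rcases (hittingSet a n q (Metric.ball z ρ)).eq_empty_or_nonempty with h | ⟨c₀, y₀, hy₀, hc₀⟩
  · rw [h, measureReal_empty]
    positivity
  have hsub : hittingSet a n q (Metric.ball z ρ) ⊆ Metric.closedBall c₀ (3 * ρ) := by
    rintro c ⟨y, hy, hc⟩
    rw [Metric.mem_ball] at hc hc₀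
    have h1 : dist (c + y) (c₀ + y₀) ≤ ρ + ρ :=
      (dist_triangle_right _ _ z).trans (add_le_add hc.le hc₀.le)
    have h2 : dist y y₀ ≤ ρ := dist_le_of_adicIndex_eq ha n (hy.trans hy₀.symm)
    have h3 : dist c c₀ ≤ dist (c + y) (c₀ + y₀) + dist y y₀ := by
      have : c - c₀ = (c + y - (c₀ + y₀)) - (y - y₀) := by abel
      simp only [dist_eq_norm]
      rw [this]
      exact norm_sub_le _ _
    rw [Metric.mem_closedBall]
    linarith
  refine (measureReal_mono hsub).trans ?_
  rw [measureReal_def, AddCircle.volume_closedBall]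
  exact ENNReal.toReal_le_of_le_ofReal (by positivity)
    (ENNReal.ofReal_le_ofReal ((min_le_right _ _).trans (by linarith)))

open Classical in
lemma volume_real_one_le_sum_le {X J : Type*} [MeasurableSpace X] {μ : Measure X}
    [IsFiniteMeasure μ] (F : Finset J) {E : J → Set X} (hE : ∀ j, MeasurableSet (E j))
    {w : J → ℝ} (hw : ∀ j, 0 ≤ w j) :
    MeasurableSet {x | 1 ≤ ∑ j ∈ F with x ∈ E j, w j} ∧
      μ.real {x | 1 ≤ ∑ j ∈ F with x ∈ E j, w j} ≤ ∑ j ∈ F, w j * μ.real (E j) := by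
  have heq : ∀ x, ∑ j ∈ F with x ∈ E j, w j = ∑ j ∈ F, (E j).indicator (fun _ => w j) x := by
    intro x
    simp [Finset.sum_filter, indicator_apply]
  have hint : ∀ j ∈ F, Integrable ((E j).indicator fun _ => w j) μ := fun j _ =>
    (integrable_const _).indicator (hE j)
  simp only [heq]
  constructor
  · exact measurableSet_le measurable_const
      (Finset.measurable_sum F fun j _ => measurable_const.indicator (hE j))
  · have h := mul_meas_ge_le_integral_of_nonneg (μ := μ)
      (f := fun x => ∑ j ∈ F, (E j).indicator (fun _ => w j) x)
      (Filter.Eventually.of_forall fun x => Finset.sum_nonneg fun j _ =>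
        indicator_nonneg (fun _ _ => hw j) x) (integrable_finsetSum F hint) 1
    rw [one_mul, integral_finsetSum F hint] at h
    refine h.trans_eq (Finset.sum_congr rfl fun j _ => ?_)
    rw [integral_indicator_const _ (hE j), smul_eq_mul, mul_comm]

/-- The growth exponent of the number of `a`-adic intervals of order `n` meeting the second
projection of `C` can be lowered, as long as the sums `x + y`, `(x, y) ∈ C`, are negligible in
dimension `s < 1`. -/
lemma exists_card_adicIndices_le {u : ℝ} (hu : Irrational u) {a : ℕ} (ha : 2 ≤ a)
    {C : Set (UnitAddCircle × UnitAddCircle)} (hcl : IsClosed C)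
    (hinv : ∀ p ∈ C, (p.1 + (u : UnitAddCircle), a • p.2) ∈ C) {s : ℝ} (hs : 0 < s) (hs1 : s < 1)
    (h0 : Measure.hausdorffMeasure s ((fun p : UnitAddCircle × UnitAddCircle => p.1 + p.2) '' C) = 0)
    {g K : ℝ} (hg : g ≤ 1)
    (hK : ∀ n : ℕ, ((adicIndices a n (Prod.snd '' C)).card : ℝ) ≤ K * (a : ℝ) ^ (g * n)) :
    ∃ K' : ℝ, ∀ n : ℕ, ((adicIndices a n (Prod.snd '' C)).card : ℝ) ≤
      K' * (a : ℝ) ^ ((g - (1 - s) / 2) * n) := by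
  classical
  have ha0 : 0 < a := by omega
  set b := (a : ℝ) with hb
  have hb1 : 1 < b := by rw [hb]; exact_mod_cast ha
  have hb0 : 0 < b := by linarith
  have hK0 : 0 ≤ K := by simpa using (Nat.cast_nonneg _).trans (hK 0)
  set t := g - (1 - s) with ht
  have ht1 : t < 1 := by linarith
  obtain ⟨δ, hδ0, hδ⟩ : ∃ δ > 0, (1 - t) * δ ≤ (1 - s) / 2 :=
    ⟨(1 - s) / 2 / (1 - t), by apply div_pos <;> linarith,
      (mul_div_cancel₀ _ (by linarith)).le⟩
  set A := (fun p : UnitAddCircle × UnitAddCircle => p.1 + p.2) '' C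
  have hAc : IsCompact A := hcl.isCompact.image continuous_add
  obtain ⟨ι, z, k, hk, hcov, hsum⟩ := exists_finite_ball_cover hAc hb1 hs h0
    (η := δ / (6 * (K + 1))) (by positivity)
  obtain ⟨r, hr, hleb⟩ := lebesgue_number_lemma_of_metric hAc
    (c := fun i : ι => Metric.ball (z i) (b⁻¹ ^ k i)) (fun _ => Metric.isOpen_ball)
    (by rwa [iUnion_subtype])
  set f : UnitAddCircle → UnitAddCircle := fun c => c + (u : UnitAddCircle) with hf
  have hfk : ∀ (m : ℕ) c, f^[m] c = c + m • (u : UnitAddCircle) := fun m c => by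
    rw [hf, add_right_iterate]
  set F := ι.sigma fun i => adicIndices a (k i) (Prod.snd '' C) with hF
  set E : (Σ _ : ℕ, ℕ) → Set UnitAddCircle := fun j =>
    hittingSet a (k j.1) j.2 (Metric.ball (z j.1) (b⁻¹ ^ k j.1))
  have hEm : ∀ j, MeasurableSet (E j) := fun j =>
    (isOpen_hittingSet _ _ _ Metric.isOpen_ball).measurableSet
  obtain ⟨hBm, hBle⟩ := volume_real_one_le_sum_le (μ := volume) F hEm
    (w := fun j => b ^ (-t * k j.1)) (fun _ => by positivity)
  have htriv : ∀ (n : ℕ) c, ((adicIndices a n (nearFiber C r c)).card : ℝ) ≤ b ^ n := by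
    intro n c
    rw [hb]
    exact_mod_cast card_adicIndices_le a n (nearFiber C r c)
  have hstep : ∀ (n : ℕ) c, ((adicIndices a (n + 1) (nearFiber C r c)).card : ℝ) ≤
      b * ((adicIndices a n (nearFiber C r (f c))).card : ℝ) := by
    intro n c
    have := card_adicIndices_le_sum (n := n + 1) ha0 (Finset.range a) (fun _ => 1) id
      (S := nearFiber C r c) (fun _ => nearFiber C r (f c)) (fun _ _ => by omega) (fun y hy =>
        ⟨adicIndex a 1 y, by simpa using adicIndex_lt ha0 1 y, rfl,
          by simpa using nsmul_mem_nearFiber hinv 1 hy⟩)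
    simp only [Nat.add_sub_cancel, Finset.sum_const, Finset.card_range, smul_eq_mul] at this
    rw [hb]
    exact_mod_cast this
  have hcover : ∀ (n : ℕ) c, (∀ j ∈ F, k j.1 ≤ n) → ((adicIndices a n (nearFiber C r c)).card : ℝ) ≤
      ∑ j ∈ F with c ∈ E j, ((adicIndices a (n - k j.1) (nearFiber C r (f^[k j.1] c))).card : ℝ) := by
    intro n c hkn
    have := card_adicIndices_le_sum (n := n) ha0 (F.filter fun j => c ∈ E j) (fun j => k j.1)
      (fun j => j.2) (S := nearFiber C r c) (fun j => nearFiber C r (f^[k j.1] c))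
      (fun j hj => hkn j (Finset.mem_filter.1 hj).1) (fun y hy => ?_)
    · exact_mod_cast this
    · obtain ⟨x, hxy, hx⟩ := id hy
      obtain ⟨i, hi⟩ := hleb (x + y) (mem_image_of_mem _ hxy)
      refine ⟨⟨i, adicIndex a (k i) y⟩, Finset.mem_filter.2 ⟨Finset.mem_sigma.2 ⟨i.2,
        (mem_adicIndices ha0).2 ⟨y, ⟨_, hxy, rfl⟩, rfl⟩⟩, y, rfl, hi ?_⟩, rfl, ?_⟩
      · rw [Metric.mem_ball, dist_add_right, dist_comm]
        exact hx
      · rw [hfk]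
        exact nsmul_mem_nearFiber hinv _ hy
  obtain ⟨K₁, hK₁, hP⟩ := count_le_rpow_birkhoffSum f
    (fun n c => ((adicIndices a n (nearFiber C r c)).card : ℝ)) hb1 F (fun j => k j.1)
    (fun j => hk j.1) E htriv hstep hcover ht1.le
  set B := {x | 1 ≤ ∑ j ∈ F with x ∈ E j, b ^ (-t * k j.1)}
  have hBδ : volume.real B ≤ δ := by
    refine hBle.trans ?_
    calc ∑ j ∈ F, b ^ (-t * k j.1) * volume.real (E j)
        ≤ ∑ j ∈ F, b ^ (-t * k j.1) * (6 * b⁻¹ ^ k j.1) := by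
          gcongr with j
          exact volume_real_hittingSet_ball_le ha0 _ _ _
      _ = ∑ i ∈ ι, (adicIndices a (k i) (Prod.snd '' C)).card *
            (b ^ (-t * k i) * (6 * b⁻¹ ^ k i)) := by
          rw [hF, Finset.sum_sigma]
          simp
      _ ≤ ∑ i ∈ ι, K * b ^ (g * k i) * (b ^ (-t * k i) * (6 * b⁻¹ ^ k i)) := by
          gcongr with i
          exact hK _
      _ = 6 * K * ∑ i ∈ ι, b ^ (-s * k i) := by
          rw [Finset.mul_sum]
          refine Finset.sum_congr rfl fun i _ => ?_
          have : b ^ (-s * k i) = b ^ (g * k i) * b ^ (-t * k i) * b⁻¹ ^ k i := by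
            rw [← Real.rpow_natCast, Real.inv_rpow hb0.le, ← Real.rpow_neg hb0.le,
              ← Real.rpow_add hb0, ← Real.rpow_add hb0, ht]
            ring_nf
          rw [this]
          ring
      _ ≤ 6 * (K + 1) * (δ / (6 * (K + 1))) := by
          gcongr
          linarith
      _ = δ := mul_div_cancel₀ _ (by positivity)
  obtain ⟨M, hM⟩ := exists_dist_nsmul_lt hu hr
  refine ⟨M * K₁ * b ^ ((1 - t) * δ * M), fun n => ?_⟩
  have : IsProbabilityMeasure (volume : Measure UnitAddCircle) := ⟨UnitAddCircle.measure_univ⟩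
  obtain ⟨c, hc⟩ := exists_birkhoffSum_indicator_le
    (measurePreserving_add_right volume (u : UnitAddCircle)) hBm (n + M)
  have hcard := card_adicIndices_le_sum (n := n) (S := Prod.snd '' C) ha0 (Finset.range M)
    (fun _ => 0) (fun _ => 0) (fun m => nearFiber C r (f^[m] c)) (fun _ _ => n.zero_le) (by
      rintro y ⟨⟨x, y⟩, hxy, rfl⟩
      obtain ⟨m, hm, hx⟩ := hM c x
      refine ⟨m, Finset.mem_range.2 hm, by simpa using adicIndex_lt ha0 0 y, x, ?_, ?_⟩
      · simpa using hxy
      · rwa [hfk])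
  calc ((adicIndices a n (Prod.snd '' C)).card : ℝ)
      ≤ ∑ m ∈ Finset.range M, ((adicIndices a n (nearFiber C r (f^[m] c))).card : ℝ) := by
        exact_mod_cast hcard
    _ ≤ ∑ m ∈ Finset.range M, K₁ * b ^ (t * n) * b ^ ((1 - t) * ((n + M : ℕ) * δ)) := by
        refine Finset.sum_le_sum fun m hm => (hP n _).trans ?_
        have h1 := birkhoffSum_iterate_le f (indicator_one_nonneg B) (k := m) (m := n) (n := n + M)
          (by have := Finset.mem_range.1 hm; omega) c
        have h2 : ((n + M : ℕ) : ℝ) * volume.real B ≤ (n + M : ℕ) * δ := by gcongr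
        gcongr
        · exact hb1.le
        · exact h1.trans (hc.trans h2)
    _ = M * K₁ * b ^ ((1 - t) * δ * M) * b ^ ((t + (1 - t) * δ) * n) := by
        rw [Finset.sum_const, Finset.card_range, nsmul_eq_mul, mul_assoc K₁, mul_assoc (M * K₁),
          ← Real.rpow_add hb0, ← Real.rpow_add hb0, mul_assoc]
        congr 3
        push_cast
        ring
    _ ≤ _ := by
        gcongr
        · exact hb1.le
        · linarith

lemma hausdorffMeasure_image_add_ne_zero {u : ℝ} (hu : Irrational u) {a : ℕ} (ha : 2 ≤ a)
    {C : Set (UnitAddCircle × UnitAddCircle)} (hne : C.Nonempty) (hcl : IsClosed C)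
    (hinv : ∀ p ∈ C, (p.1 + (u : UnitAddCircle), a • p.2) ∈ C) {s : ℝ} (hs : 0 < s)
    (hs1 : s < 1) :
    Measure.hausdorffMeasure s ((fun p : UnitAddCircle × UnitAddCircle => p.1 + p.2) '' C) ≠ 0 := by
  intro h0
  have hb1 : (1 : ℝ) < a := by exact_mod_cast ha
  have hgrowth : ∀ j : ℕ, ∃ K : ℝ, ∀ n : ℕ, ((adicIndices a n (Prod.snd '' C)).card : ℝ) ≤
      K * (a : ℝ) ^ ((1 - j * ((1 - s) / 2)) * n) := by
    intro j
    induction j with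
    | zero => exact ⟨1, fun n => by simpa using mod_cast card_adicIndices_le a n _⟩
    | succ j ih =>
      obtain ⟨K, hK⟩ := ih
      obtain ⟨K', hK'⟩ := exists_card_adicIndices_le hu ha hcl hinv hs hs1 h0
        (by have : 0 ≤ j * ((1 - s) / 2) := by apply mul_nonneg <;> [positivity; linarith]
            linarith) hK
      refine ⟨K', fun n => (hK' n).trans_eq ?_⟩
      push_cast
      ring_nf
  obtain ⟨j, hj⟩ := exists_nat_gt (1 / ((1 - s) / 2))
  rw [div_lt_iff₀ (by linarith)] at hj
  obtain ⟨K, hK⟩ := hgrowth j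
  have hlim : Filter.Tendsto (fun n : ℕ => K * ((a : ℝ) ^ (1 - j * ((1 - s) / 2))) ^ n)
      Filter.atTop (nhds (K * 0)) :=
    (tendsto_pow_atTop_nhds_zero_of_lt_one (by positivity)
      (Real.rpow_lt_one_of_one_lt_of_neg hb1 (by linarith))).const_mul K
  rw [mul_zero] at hlim
  obtain ⟨n, hn⟩ := (hlim.eventually_lt_const one_pos).exists
  have h1 : 1 ≤ (adicIndices a n (Prod.snd '' C)).card := by
    obtain ⟨p, hp⟩ := hne
    exact Finset.card_pos.2 ⟨_, (mem_adicIndices (by omega)).2 ⟨p.2, mem_image_of_mem _ hp, rfl⟩⟩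
  have h2 := hK n
  rw [Real.rpow_mul_natCast (by positivity)] at h2
  have h3 : (1 : ℝ) ≤ (adicIndices a n (Prod.snd '' C)).card := by exact_mod_cast h1
  linarith

/-- If `C ⊆ 𝕋 × 𝕋` is nonempty, closed and forward invariant under
`R_u × S_a` (rotation by an irrational `u` times multiplication by an integer
`a ≥ 2`), then the image of `C` under `σ(x,y) = x + y` has Hausdorff
dimension `1`. -/
theorem yu_theorem_invariant_set (u : ℝ) (hu : Irrational u)
    (a : ℕ) (ha : 2 ≤ a)
    (C : Set (AddCircle (1 : ℝ) × AddCircle (1 : ℝ)))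
    (hne : C.Nonempty) (hcl : IsClosed C)
    (hinv : ∀ p ∈ C, (p.1 + (u : AddCircle (1 : ℝ)), a • p.2) ∈ C) :
    dimH ((fun p : AddCircle (1 : ℝ) × AddCircle (1 : ℝ) => p.1 + p.2) '' C)
      = 1 := by
  refine le_antisymm ((dimH_mono (subset_univ _)).trans dimH_univ_unitAddCircle_le) ?_
  by_contra! hlt
  obtain ⟨s, hs, hs1⟩ := ENNReal.lt_iff_exists_nnreal_btwn.1 hlt
  have hs0 : (0 : ℝ) < s := by
    exact_mod_cast zero_le.trans_lt hs
  exact hausdorffMeasure_image_add_ne_zero hu ha hne hcl hinv hs0 (by exact_mod_cast hs1)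
    (hausdorffMeasure_of_dimH_lt hs)
end

section
/- Let ⟨u_n⟩_{n≥0} be any sequence of real numbers. Then there exists v ∈ [0,1) such that for every n ≥ 0, the fractional part Int.fract(u_n + 10^n · v) lies in the interval [0, 2/10]. -/
open Set

/-- The left endpoints of nested intervals `[a_n, a_n + (2/10) / 10^n]`: each `a_{n+1}` is the least
`x ≥ a_n` such that `u_{n+1} + 10^{n+1} x` is an integer. -/
noncomputable def leftEndpoint (u : ℕ → ℝ) : ℕ → ℝ
  | 0 => -u 0
  | n + 1 => (⌈u (n + 1) + 10 ^ (n + 1) * leftEndpoint u n⌉ - u (n + 1)) / 10 ^ (n + 1)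

theorem exists_int_eq_add_leftEndpoint (u : ℕ → ℝ) (n : ℕ) :
    ∃ k : ℤ, u n + 10 ^ n * leftEndpoint u n = k := by
  cases n with
  | zero => exact ⟨0, by simp [leftEndpoint]⟩
  | succ n =>
    refine ⟨⌈u (n + 1) + 10 ^ (n + 1) * leftEndpoint u n⌉, ?_⟩
    rw [leftEndpoint]
    field_simp
    ring

theorem monotone_leftEndpoint (u : ℕ → ℝ) : Monotone (leftEndpoint u) := by
  refine monotone_nat_of_le_succ fun n => ?_
  rw [leftEndpoint, le_div_iff₀ (by positivity)]
  linarith [Int.le_ceil (u (n + 1) + 10 ^ (n + 1) * leftEndpoint u n)]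

theorem antitone_rightEndpoint (u : ℕ → ℝ) :
    Antitone fun n => leftEndpoint u n + 2 / 10 / 10 ^ n := by
  refine antitone_nat_of_succ_le fun n => ?_
  have h := Int.ceil_lt_add_one (u (n + 1) + 10 ^ (n + 1) * leftEndpoint u n)
  have h10 : (2 / 10 / 10 ^ n : ℝ) = 2 / 10 ^ (n + 1) := by
    rw [pow_succ]
    field_simp
  rw [h10, leftEndpoint, ← add_div, div_le_iff₀ (by positivity), add_mul,
    div_mul_cancel₀ _ (by positivity)]
  linarith

theorem fract_mem_Icc_of_int_le {x c : ℝ} (hc : c < 1) (k : ℤ) (h : x ∈ Icc (k : ℝ) (k + c)) :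
    Int.fract x ∈ Icc 0 c := by
  have hk : ⌊x⌋ = k := Int.floor_eq_iff.2 ⟨h.1, by linarith [h.2]⟩
  rw [Int.fract, hk]
  exact ⟨by linarith [h.1], by linarith [h.2]⟩

/-- Given any sequence `⟨u_n⟩` of reals, one can choose `v ∈ [0,1)` digit by
digit so that `u_n + 10^n v` lies in `[0, 2/10]` modulo `1` for every `n`. -/
theorem exists_v_fract_small (u : ℕ → ℝ) :
    ∃ v ∈ Set.Ico (0 : ℝ) 1, ∀ n : ℕ,
      Int.fract (u n + 10 ^ n * v) ∈ Set.Icc (0 : ℝ) (2 / 10) := by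
  have hmem := (monotone_leftEndpoint u).ciSup_mem_iInter_Icc_of_antitone
    (antitone_rightEndpoint u) fun n => le_add_of_nonneg_right (by positivity)
  set w := ⨆ n, leftEndpoint u n
  refine ⟨Int.fract w, ⟨Int.fract_nonneg w, Int.fract_lt_one w⟩, fun n => ?_⟩
  obtain ⟨hl, hr⟩ := mem_iInter.1 hmem n
  obtain ⟨k, hk⟩ := exists_int_eq_add_leftEndpoint u n
  have hshift : u n + 10 ^ n * Int.fract w = u n + 10 ^ n * w - ((10 ^ n * ⌊w⌋ : ℤ) : ℝ) := by
    rw [Int.fract]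
    push_cast
    ring
  rw [hshift, Int.fract_sub_intCast]
  have hpos : (0 : ℝ) < 10 ^ n := by positivity
  refine fract_mem_Icc_of_int_le (by norm_num) k ⟨?_, ?_⟩
  · rw [← hk]
    gcongr
  · have h := mul_le_mul_of_nonneg_left hr hpos.le
    rw [mul_add, mul_div_cancel₀ _ hpos.ne'] at h
    linarith
end

section
/- Let u ∈ (0,1) be a real number. For t ∈ [0,1) and n ∈ ℕ, let m(t,n) denote the number of indices k ∈ {0, 1, …, n−1} such that Int.fract(t + k·(1−u)) ∈ [0, u). Then |m(t,n) − u·n| ≤ 1 for all t ∈ [0,1) and all n ∈ ℕ. -/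
open Set

/-- Translating by `1 - u` changes the fractional part by `-u` or `1 - u`, according to whether
the wrap-around point is passed. -/
lemma fract_add_one_sub {u : ℝ} (hu : u ∈ Set.Icc (0 : ℝ) 1) (y : ℝ) :
    Int.fract (y + (1 - u)) =
      Int.fract y - u + if Int.fract y < u then 1 else 0 := by
  have h0 := Int.fract_nonneg y
  have h1 := Int.fract_lt_one y
  have hy := Int.floor_add_fract y
  rw [Int.fract_eq_iff]
  split_ifs with h
  · exact ⟨by linarith [hu.2], by linarith, ⌊y⌋, by linarith⟩
  · exact ⟨by linarith, by linarith [hu.1], ⌊y⌋ + 1, by push_cast; linarith⟩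

open scoped Classical in
/-- The discrepancy of the visits of the orbit of `t` to `[0, u)` is a coboundary. -/
lemma card_filter_fract_orbit {u : ℝ} (hu : u ∈ Set.Icc (0 : ℝ) 1) (t : ℝ) (n : ℕ) :
    (((Finset.range n).filter fun k : ℕ =>
        Int.fract (t + k * (1 - u)) ∈ Set.Ico (0 : ℝ) u).card : ℝ) =
      u * n + Int.fract (t + n * (1 - u)) - Int.fract t := by
  induction n with
  | zero => simp
  | succ n ih =>
    have hstep := fract_add_one_sub hu (t + n * (1 - u))
    have hn : t + ((n + 1 : ℕ) : ℝ) * (1 - u) = t + n * (1 - u) + (1 - u) := by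
      push_cast; ring
    rw [hn, hstep, Finset.card_filter, Finset.sum_range_succ, ← Finset.card_filter]
    simp only [Set.mem_Ico, Int.fract_nonneg, true_and] at ih ⊢
    push_cast
    rw [ih]
    ring

open scoped Classical in
/-- **Furstenberg's counting estimate (Lemma 7 of Furstenberg 1970).**
For `u ∈ (0,1)`, the number `m(t,n)` of indices `k < n` with
`{t + k(1-u)} ∈ [0,u)` satisfies `|m(t,n) - u n| ≤ 1`. -/
theorem fract_orbit_count_estimate
    (u : ℝ) (hu : u ∈ Set.Ioo (0 : ℝ) 1)
    (t : ℝ) (ht : t ∈ Set.Ico (0 : ℝ) 1) (n : ℕ) :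
    |(((Finset.range n).filter fun k =>
        Int.fract (t + k * (1 - u)) ∈ Set.Ico (0 : ℝ) u).card - u * n : ℝ)|
      ≤ 1 := by
  have hcard := card_filter_fract_orbit (Set.Ioo_subset_Icc_self hu) t n
  rw [← Finset.card_image_of_injective _ (Nat.cast_injective (R := ℝ)),
    Int.fract_eq_self.mpr ht] at hcard
  -- The filter in the goal ranges over a finset of reals, the image of `Finset.range n` under the cast.
  convert_to |(((((Finset.range n).filter fun k : ℕ =>
      Int.fract (t + k * (1 - u)) ∈ Set.Ico (0 : ℝ) u).image (Nat.cast : ℕ → ℝ)).card : ℝ)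
        - u * n)| ≤ 1
  · congr 4
    ext x
    simp only [Finset.mem_filter, Finset.mem_image, Finset.bind_def, Finset.pure_def,
      Finset.mem_sup, Finset.mem_singleton]
    aesop
  rw [hcard, abs_le]
  have h0 := Int.fract_nonneg (t + n * (1 - u))
  have h1 := Int.fract_lt_one (t + n * (1 - u))
  constructor <;> linarith [ht.1, ht.2]
end

section
/- Let a ≥ 2 be an integer and let C ⊆ 𝕋 × 𝕋 be a set such that the second-coordinate projection π₂[C] ⊆ 𝕋 is closed and forward invariant under S_a (i.e., y ∈ π₂[C] implies a·y ∈ π₂[C]). Let σ : 𝕋 × 𝕋 → 𝕋 be the map σ(x,y) = x + y. Then dimH C ≤ dimH(σ[C]) + dimH(π₂[C]). -/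
open MeasureTheory Set
open scoped NNReal ENNReal

/-- A set of null `d`-dimensional Hausdorff measure has open covers by sets of diameter at most
`q ^ k n`, with all `k n` large and `∑ (q ^ d) ^ k n` small. -/
theorem exists_isOpen_cover_of_hausdorffMeasure_eq_zero {X : Type*} [EMetricSpace X]
    [MeasurableSpace X] [BorelSpace X] {q : ℝ≥0} (hq0 : 0 < q) (hq1 : q < 1) {d : ℝ} (hd : 0 < d)
    {S : Set X} (hS : μH[d] S = 0) {ε : ℝ≥0} (hε : 0 < ε) (M : ℕ) :
    ∃ (U : ℕ → Set X) (k : ℕ → ℕ), (∀ n, IsOpen (U n)) ∧ (S ⊆ ⋃ n, U n) ∧ (∀ n, M ≤ k n) ∧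
      (∀ n, Metric.ediam (U n) ≤ (q ^ k n : ℝ≥0)) ∧
      ∑' n, (((q ^ d) ^ k n : ℝ≥0) : ℝ≥0∞) < ε := by
  set A : ℝ≥0 := (q ^ d)⁻¹ * 3 ^ d
  have hA0 : 0 < A := by positivity
  set η : ℝ≥0 := ε / (2 * A) with hη
  have hη0 : 0 < η := by positivity
  set δ : ℝ≥0 := q ^ (M + 1) / 3 with hδ
  have hδ0 : 0 < δ := by positivity
  rw [Measure.hausdorffMeasure_apply] at hS
  have h1 := (iSup₂_le_iff.1 hS.le) (δ : ℝ≥0∞) (by exact_mod_cast hδ0)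
  have h2 := lt_of_le_of_lt h1 (show (0 : ℝ≥0∞) < η by exact_mod_cast hη0)
  simp only [iInf_lt_iff] at h2
  obtain ⟨t, hSt, htδ, hsum⟩ := h2
  obtain ⟨ρ, hρ0, hρs⟩ := ENNReal.exists_pos_sum_of_countable
    (show (η : ℝ≥0∞) ≠ 0 by exact_mod_cast hη0.ne') ℕ
  have hfin : ∀ n, Metric.ediam (t n) ≠ ∞ := fun n => ne_top_of_le_ne_top ENNReal.coe_ne_top (htδ n)
  set D : ℕ → ℝ≥0 := fun n => (Metric.ediam (t n)).toNNReal with hD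
  have hDc : ∀ n, (D n : ℝ≥0∞) = Metric.ediam (t n) := fun n => ENNReal.coe_toNNReal (hfin n)
  set r : ℕ → ℝ≥0 := fun n => max (D n) (min δ (ρ n ^ (1 / d))) with hr
  have hr0 : ∀ n, 0 < r n := fun n =>
    lt_max_of_lt_right (lt_min hδ0 (NNReal.rpow_pos (hρ0 n)))
  have hrδ : ∀ n, r n ≤ δ := fun n =>
    max_le (by have := htδ n; rw [← hDc] at this; exact_mod_cast this) (min_le_left _ _)
  have hrd : ∀ n, r n ^ d ≤ D n ^ d + ρ n := by
    intro n
    rcases max_cases (D n) (min δ (ρ n ^ (1 / d))) with h | h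
    · simp only [hr, h.1]; exact le_self_add
    · simp only [hr, h.1]
      calc _ ≤ (ρ n ^ (1 / d)) ^ d := NNReal.rpow_le_rpow (min_le_right _ _) hd.le
        _ = ρ n := by rw [← NNReal.rpow_mul, one_div_mul_cancel hd.ne', NNReal.rpow_one]
        _ ≤ _ := le_add_self
  have h3r : ∀ n, 3 * r n ≤ q ^ (M + 1) := fun n => by
    calc 3 * r n ≤ 3 * δ := by gcongr; exact hrδ n
      _ = _ := by rw [hδ]; field_simp
  have hk : ∀ n, ∃ k, q ^ (k + 1) < 3 * r n ∧ 3 * r n ≤ q ^ k := fun n =>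
    exists_nat_pow_near_of_lt_one (mul_pos (by norm_num) (hr0 n))
      ((h3r n).trans (pow_le_one₀ zero_le hq1.le)) hq0 hq1
  choose k hk1 hk2 using hk
  refine ⟨fun n => Metric.thickening (r n) (t n), k, fun n => Metric.isOpen_thickening,
    hSt.trans (iUnion_mono fun n => Metric.self_subset_thickening (by exact_mod_cast hr0 n) _),
    fun n => ?_, fun n => ?_, ?_⟩
  · have := (hk1 n).trans_le (h3r n)
    rw [pow_lt_pow_iff_right_of_lt_one₀ hq0 hq1] at this
    omega
  · refine (Metric.ediam_thickening_le _).trans ?_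
    rw [← hDc]
    calc _ ≤ (r n : ℝ≥0∞) + 2 * r n := by
          gcongr
          exact le_max_left _ _
      _ = ((3 * r n : ℝ≥0) : ℝ≥0∞) := by push_cast; ring
      _ ≤ _ := by exact_mod_cast hk2 n
  · have hterm : ∀ n, (((q ^ d) ^ k n : ℝ≥0) : ℝ≥0∞) ≤
        A * ((⨆ _ : (t n).Nonempty, Metric.ediam (t n) ^ d) + ρ n) := by
      intro n
      have hs : (⨆ _ : (t n).Nonempty, Metric.ediam (t n) ^ d) = ((D n ^ d : ℝ≥0) : ℝ≥0∞) := by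
        rcases (t n).eq_empty_or_nonempty with h | h
        · simp [hD, h, hd.ne', hd]
        · simp only [h, iSup_pos]
          rw [ENNReal.coe_rpow_of_nonneg _ hd.le, hDc]
      rw [hs]
      have : (q ^ d) ^ k n ≤ A * (D n ^ d + ρ n) := by
        calc (q ^ d) ^ k n = (q ^ d)⁻¹ * (q ^ (k n + 1)) ^ d := by
              rw [← NNReal.rpow_natCast, ← NNReal.rpow_natCast, ← NNReal.rpow_mul,
                ← NNReal.rpow_mul, ← NNReal.rpow_neg, ← NNReal.rpow_add hq0.ne']
              congr 1; push_cast; ring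
          _ ≤ (q ^ d)⁻¹ * (3 * r n) ^ d := by gcongr; exact (hk1 n).le
          _ = A * r n ^ d := by rw [NNReal.mul_rpow]; ring
          _ ≤ _ := by gcongr; exact hrd n
      exact_mod_cast this
    calc _ ≤ ∑' n, (A : ℝ≥0∞) * ((⨆ _ : (t n).Nonempty, Metric.ediam (t n) ^ d) + ρ n) :=
          ENNReal.tsum_le_tsum hterm
      _ = A * (∑' n, (⨆ _ : (t n).Nonempty, Metric.ediam (t n) ^ d) + ∑' n, (ρ n : ℝ≥0∞)) := by
          rw [ENNReal.tsum_mul_left, ENNReal.tsum_add]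
      _ < A * (η + η) := by
          refine ENNReal.mul_lt_mul_right (by exact_mod_cast hA0.ne') ENNReal.coe_ne_top ?_
          exact ENNReal.add_lt_add hsum hρs
      _ = ε := by
          have : A * (η + η) = ε := by rw [hη]; field_simp; ring
          exact_mod_cast this

theorem AddCircle.norm_nsmul_of_mul_norm_le {n : ℕ} {y : AddCircle (1 : ℝ)}
    (h : n * ‖y‖ ≤ 1 / 2) : ‖n • y‖ = n * ‖y‖ := by
  obtain ⟨x, rfl, hx⟩ : ∃ x : ℝ, (x : AddCircle (1 : ℝ)) = y ∧ ‖(x : AddCircle (1 : ℝ))‖ = |x| := by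
    obtain ⟨x, rfl⟩ := QuotientAddGroup.mk_surjective y
    refine ⟨x - round x, ?_, ?_⟩
    · rw [AddCircle.coe_sub, sub_eq_self, AddCircle.coe_eq_zero_iff]
      exact ⟨round x, by simp⟩
    · rw [AddCircle.norm_coe_eq_abs_iff 1 one_ne_zero]
      simpa using abs_sub_round x
  rw [hx] at h ⊢
  rw [← AddCircle.coe_nsmul, (AddCircle.norm_coe_eq_abs_iff 1 one_ne_zero).2] <;>
    simp [abs_mul]
  simpa using h

theorem ediam_inter_preimage_nsmul_le {a : ℕ} (ha : 2 ≤ a) {U V : Set (AddCircle (1 : ℝ))}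
    {j m : ℕ} (hU : Metric.ediam U ≤ (((a : ℝ≥0)⁻¹ ^ (j + 1) : ℝ≥0) : ℝ≥0∞))
    (hV : Metric.ediam V ≤ (((a : ℝ≥0)⁻¹ ^ m : ℝ≥0) : ℝ≥0∞)) :
    Metric.ediam (U ∩ (fun y => a ^ j • y) ⁻¹' V) ≤
      (((a : ℝ≥0)⁻¹ ^ (j + m) : ℝ≥0) : ℝ≥0∞) := by
  have ha0 : (0 : ℝ) < a := by positivity
  have ha2 : (2 : ℝ) ≤ a := by exact_mod_cast ha
  refine Metric.ediam_le fun y hy z hz => ?_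
  have h1 := (Metric.edist_le_ediam_of_mem hy.1 hz.1).trans hU
  have h2 := (Metric.edist_le_ediam_of_mem (mem_preimage.1 hy.2) (mem_preimage.1 hz.2)).trans hV
  rw [edist_le_coe, ← NNReal.coe_le_coe, coe_nndist, dist_eq_norm] at h1 h2 ⊢
  push_cast at h1 h2 ⊢
  have h3 : ((a ^ j : ℕ) : ℝ) * ‖y - z‖ ≤ 1 / 2 := by
    calc ((a ^ j : ℕ) : ℝ) * ‖y - z‖ ≤ (a : ℝ) ^ j * (a : ℝ)⁻¹ ^ (j + 1) := by
          push_cast; gcongr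
      _ = (a : ℝ)⁻¹ := by rw [pow_succ, ← mul_assoc, ← mul_pow, mul_inv_cancel₀ ha0.ne']; simp
      _ ≤ 1 / 2 := by rw [one_div]; gcongr
  rw [← smul_sub, AddCircle.norm_nsmul_of_mul_norm_le h3] at h2
  push_cast at h2
  calc ‖y - z‖ = (a : ℝ)⁻¹ ^ j * ((a : ℝ) ^ j * ‖y - z‖) := by
        rw [← mul_assoc, ← mul_pow, inv_mul_cancel₀ ha0.ne']; simp
    _ ≤ (a : ℝ)⁻¹ ^ j * (a : ℝ)⁻¹ ^ m := by gcongr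
    _ = _ := (pow_add _ _ _).symm

/-- **Furstenberg**: a closed forward invariant set of null `d`-dimensional Hausdorff measure can be
covered by `O(a ^ (n * d))` sets of diameter at most `a ^ (-n)`. -/
theorem exists_finset_cover_card_mul_le {a : ℕ} (ha : 2 ≤ a) {Y : Set (AddCircle (1 : ℝ))}
    (hcl : IsClosed Y) (hinv : ∀ y ∈ Y, a • y ∈ Y) {d : ℝ} (hd : 0 < d) (hY : μH[d] Y = 0) :
    ∃ K : ℝ≥0, ∀ n : ℕ, ∃ F : Finset (Set (AddCircle (1 : ℝ))),
      (∀ V ∈ F, Metric.ediam V ≤ (((a : ℝ≥0)⁻¹ ^ n : ℝ≥0) : ℝ≥0∞)) ∧ (Y ⊆ ⋃ V ∈ F, V) ∧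
        F.card * ((a : ℝ≥0)⁻¹ ^ d) ^ n ≤ K := by
  classical
  have ha0 : (0 : ℝ≥0) < a := by positivity
  have ha1 : (1 : ℝ≥0) < a := by exact_mod_cast ha
  set q : ℝ≥0 := (a : ℝ≥0)⁻¹ with hq
  have hq0 : 0 < q := inv_pos.2 ha0
  have hq1 : q < 1 := inv_lt_one_of_one_lt₀ ha1
  set w : ℝ≥0 := q ^ d with hw
  have hw0 : 0 < w := NNReal.rpow_pos hq0
  have hw1 : w ≤ 1 := NNReal.rpow_le_one hq1.le hd.le
  have hinvp : ∀ j : ℕ, ∀ y ∈ Y, a ^ j • y ∈ Y := by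
    intro j
    induction j with
    | zero => simp
    | succ j ih => intro y hy; rw [pow_succ', mul_smul]; exact hinv _ (ih y hy)
  obtain ⟨U, k, hUo, hYU, hk, hUd, hsum⟩ :=
    exists_isOpen_cover_of_hausdorffMeasure_eq_zero hq0 hq1 hd hY hw0 2
  obtain ⟨I, hI⟩ := hcl.isCompact.elim_finite_subcover U hUo hYU
  have hIsum : ∑ i ∈ I, w ^ (k i - 1) ≤ 1 := by
    have h1 : ∑ i ∈ I, w ^ k i ≤ w := by
      have := (ENNReal.sum_le_tsum I).trans hsum.le
      exact_mod_cast this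
    have h2 : w * ∑ i ∈ I, w ^ (k i - 1) ≤ w * 1 := by
      rw [Finset.mul_sum, mul_one]
      refine le_trans (Finset.sum_le_sum fun i _ => ?_) h1
      rw [← pow_succ', Nat.sub_add_cancel (by have := hk i; omega)]
    exact le_of_mul_le_mul_left h2 hw0
  set N := I.sup k
  obtain ⟨B, hBd, hB⟩ : ∃ B : Finset (Set (AddCircle (1 : ℝ))),
      (∀ V ∈ B, Metric.ediam V ≤ ((q ^ N : ℝ≥0) : ℝ≥0∞)) ∧ Y ⊆ ⋃ V ∈ B, V := by
    obtain ⟨t, -, ht, hYt⟩ := finite_cover_balls_of_compact hcl.isCompact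
      (show (0 : ℝ) < (q ^ N / 2 : ℝ≥0) by exact_mod_cast (by positivity : 0 < q ^ N / 2))
    refine ⟨ht.toFinset.image fun x => Metric.ball x (q ^ N / 2 : ℝ≥0), ?_, by simpa using hYt⟩
    intro V hV
    obtain ⟨x, -, rfl⟩ := Finset.mem_image.1 hV
    rw [← Metric.eball_coe]
    refine Metric.ediam_eball_le.trans (le_of_eq ?_)
    have : 2 * (q ^ N / 2) = q ^ N := by field_simp
    exact_mod_cast this
  refine ⟨B.card, fun n => ?_⟩
  induction n using Nat.strong_induction_on with
  | _ n ih =>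
    rcases le_or_gt n N with hn | hn
    · refine ⟨B, fun V hV => (hBd V hV).trans ?_, hB,
        mul_le_of_le_one_right' (pow_le_one₀ zero_le hw1)⟩
      exact_mod_cast pow_le_pow_of_le_one zero_le hq1.le hn
    choose F hFd hFc hFk using fun i => ih (n - (k i - 1)) (by have := hk i; omega)
    have hkn : ∀ i ∈ I, k i < n := fun i hi => (Finset.le_sup hi).trans_lt hn
    refine ⟨I.biUnion fun i => (F i).image fun V => U i ∩ (fun y => a ^ (k i - 1) • y) ⁻¹' V,
      ?_, ?_, ?_⟩
    · intro W hW
      obtain ⟨i, hi, hW⟩ := Finset.mem_biUnion.1 hW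
      obtain ⟨V, hV, rfl⟩ := Finset.mem_image.1 hW
      have hi1 := hk i
      have hi2 := hkn i hi
      have := ediam_inter_preimage_nsmul_le ha (j := k i - 1)
        (by rw [Nat.sub_add_cancel (by omega)]; exact hUd i) (hFd i V hV)
      rwa [Nat.add_sub_cancel' (by omega)] at this
    · intro y hy
      obtain ⟨i, hi, hyi⟩ := mem_iUnion₂.1 (hI hy)
      obtain ⟨V, hV, hyV⟩ := mem_iUnion₂.1 (hFc i (hinvp (k i - 1) y hy))
      exact mem_iUnion₂.2 ⟨_, Finset.mem_biUnion.2 ⟨i, hi, Finset.mem_image_of_mem _ hV⟩, hyi, hyV⟩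
    · calc _ ≤ ((∑ i ∈ I, (F i).card : ℕ) : ℝ≥0) * w ^ n := by
            gcongr
            exact Finset.card_biUnion_le.trans (Finset.sum_le_sum fun i _ => Finset.card_image_le)
        _ = ∑ i ∈ I, w ^ (k i - 1) * ((F i).card * w ^ (n - (k i - 1))) := by
            rw [Nat.cast_sum, Finset.sum_mul]
            refine Finset.sum_congr rfl fun i hi => ?_
            have := hkn i hi
            rw [mul_left_comm, ← pow_add, Nat.add_sub_cancel' (by omega)]
        _ ≤ ∑ i ∈ I, w ^ (k i - 1) * B.card := by gcongr with i; exact hFk i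
        _ ≤ B.card := by
            rw [← Finset.sum_mul]
            exact mul_le_of_le_one_left zero_le hIsum

/-- The product of an `s`-dimensionally null set with a set of upper box dimension at most `t`,
witnessed along the scales `q ^ n`, has finite `(s + t)`-dimensional Hausdorff measure. -/
theorem hausdorffMeasure_prod_ne_top {X Y : Type*} [EMetricSpace X] [EMetricSpace Y]
    [MeasurableSpace X] [BorelSpace X] [MeasurableSpace (X × Y)] [BorelSpace (X × Y)]
    {q : ℝ≥0} (hq0 : 0 < q) (hq1 : q < 1) {s t : ℝ} (hs : 0 < s) (ht : 0 < t) {A : Set X}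
    (hA : μH[s] A = 0) {B : Set Y} {K : ℝ≥0}
    (hB : ∀ n : ℕ, ∃ F : Finset (Set Y), (∀ V ∈ F, Metric.ediam V ≤ ((q ^ n : ℝ≥0) : ℝ≥0∞)) ∧
      (B ⊆ ⋃ V ∈ F, V) ∧ F.card * (q ^ t) ^ n ≤ K) :
    μH[s + t] (A ×ˢ B) ≠ ∞ := by
  choose F hFd hFc hFk using hB
  choose U k _ hAU hk hUd hsum using fun M =>
    exists_isOpen_cover_of_hausdorffMeasure_eq_zero hq0 hq1 hs hA one_pos M
  have hd : ∀ M (p : Σ i : ℕ, F (k M i)), Metric.ediam (U M p.1 ×ˢ (p.2 : Set Y)) ≤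
      ((q ^ k M p.1 : ℝ≥0) : ℝ≥0∞) := by
    rintro M ⟨i, V, hV⟩
    refine Metric.ediam_le fun x hx y hy => ?_
    rw [Prod.edist_eq]
    exact max_le ((Metric.edist_le_ediam_of_mem hx.1 hy.1).trans (hUd M i))
      ((Metric.edist_le_ediam_of_mem hx.2 hy.2).trans (hFd _ V hV))
  have hlim : Filter.Tendsto (fun M : ℕ => ((q ^ M : ℝ≥0) : ℝ≥0∞)) Filter.atTop (nhds 0) := by
    exact ENNReal.tendsto_coe.2 (tendsto_pow_atTop_nhds_zero_of_lt_one zero_le hq1)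
  have hmain := Measure.hausdorffMeasure_le_liminf_tsum (s + t) (A ×ˢ B) _ hlim
    (fun M (p : Σ i : ℕ, F (k M i)) => U M p.1 ×ˢ (p.2 : Set Y))
    (Filter.Eventually.of_forall fun M p => (hd M p).trans <| by
      exact_mod_cast pow_le_pow_of_le_one zero_le hq1.le (hk M p.1))
    (Filter.Eventually.of_forall fun M x hx => by
      obtain ⟨i, hi⟩ := mem_iUnion.1 (hAU M hx.1)
      obtain ⟨V, hV, hxV⟩ := mem_iUnion₂.1 (hFc (k M i) hx.2)
      exact mem_iUnion.2 ⟨⟨i, V, hV⟩, hi, hxV⟩)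
  refine ne_top_of_le_ne_top (ENNReal.coe_ne_top (r := K)) (hmain.trans ?_)
  refine (Filter.liminf_le_liminf (Filter.Eventually.of_forall fun M => ?_)).trans_eq
    (Filter.liminf_const (f := (Filter.atTop : Filter ℕ)) (K : ℝ≥0∞))
  calc _ ≤ ∑' p : Σ i : ℕ, F (k M i), (((q ^ k M p.1) ^ (s + t) : ℝ≥0) : ℝ≥0∞) := by
        refine ENNReal.tsum_le_tsum fun p => ?_
        rw [ENNReal.coe_rpow_of_nonneg _ (by positivity)]
        gcongr
        exact hd M p
    _ = ∑' i, (((F (k M i)).card * (q ^ k M i) ^ (s + t) : ℝ≥0) : ℝ≥0∞) := by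
        rw [ENNReal.tsum_sigma']
        congr 1 with i
        simp [tsum_fintype]
    _ ≤ ∑' i, (K : ℝ≥0∞) * (((q ^ s) ^ k M i : ℝ≥0) : ℝ≥0∞) := by
        refine ENNReal.tsum_le_tsum fun i => ?_
        have : (F (k M i)).card * (q ^ k M i) ^ (s + t) ≤ K * (q ^ s) ^ k M i := by
          calc _ = (F (k M i)).card * (q ^ t) ^ k M i * (q ^ s) ^ k M i := by
                rw [NNReal.rpow_add (pow_pos hq0 _).ne', ← NNReal.rpow_natCast,
                  ← NNReal.rpow_natCast, ← NNReal.rpow_natCast, ← NNReal.rpow_mul,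
                  ← NNReal.rpow_mul, ← NNReal.rpow_mul,
                  ← NNReal.rpow_mul, mul_comm s, mul_comm t]
                ring
            _ ≤ _ := by gcongr; exact hFk _
        exact_mod_cast this
    _ ≤ K := by
        rw [ENNReal.tsum_mul_left]
        exact mul_le_of_le_one_right' (by exact_mod_cast (hsum M).le)

theorem dimH_prod_le_of_isClosed_of_forall_nsmul_mem {a : ℕ} (ha : 2 ≤ a)
    (E : Set (AddCircle (1 : ℝ))) {Y : Set (AddCircle (1 : ℝ))}
    (hcl : IsClosed Y) (hinv : ∀ y ∈ Y, a • y ∈ Y) :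
    dimH (E ×ˢ Y) ≤ dimH E + dimH Y := by
  have ha1 : (1 : ℝ≥0) < a := by exact_mod_cast ha
  borelize (AddCircle (1 : ℝ) × AddCircle (1 : ℝ))
  refine ENNReal.le_of_forall_pos_le_add fun ε hε hfin => ?_
  obtain ⟨hE, hY⟩ := ENNReal.add_lt_top.1 hfin
  lift dimH E to ℝ≥0 using hE.ne with e he
  lift dimH Y to ℝ≥0 using hY.ne with y hy
  have hsE : μH[((e + ε / 2 : ℝ≥0) : ℝ)] E = 0 := hausdorffMeasure_of_dimH_lt <| by
    rw [← he]; exact_mod_cast lt_add_of_pos_right e (half_pos hε)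
  have hsY : μH[((y + ε / 2 : ℝ≥0) : ℝ)] Y = 0 := hausdorffMeasure_of_dimH_lt <| by
    rw [← hy]; exact_mod_cast lt_add_of_pos_right y (half_pos hε)
  have hsp : (0 : ℝ) < (e + ε / 2 : ℝ≥0) := by
    exact_mod_cast (by positivity : 0 < e + ε / 2)
  have htp : (0 : ℝ) < (y + ε / 2 : ℝ≥0) := by
    exact_mod_cast (by positivity : 0 < y + ε / 2)
  obtain ⟨K, hK⟩ := exists_finset_cover_card_mul_le ha hcl hinv htp hsY
  have h := hausdorffMeasure_prod_ne_top (inv_pos.2 (one_pos.trans ha1))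
    (inv_lt_one_of_one_lt₀ ha1) hsp htp hsE hK
  rw [← NNReal.coe_add] at h
  refine (dimH_le_of_hausdorffMeasure_ne_top h).trans_eq ?_
  have : e + ε / 2 + (y + ε / 2) = e + y + ε := by
    rw [add_add_add_comm, add_halves]
  exact_mod_cast this

/-- If `C ⊆ 𝕋 × 𝕋` has second-coordinate projection closed and forward
invariant under multiplication by an integer `a ≥ 2`, then
`dimH C ≤ dimH (σ[C]) + dimH (π₂[C])`, where `σ(x,y) = x + y`. -/
theorem dimH_le_sum_image_add_proj
    (a : ℕ) (ha : 2 ≤ a)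
    (C : Set (AddCircle (1 : ℝ) × AddCircle (1 : ℝ)))
    (hcl : IsClosed (Prod.snd '' C))
    (hinv : ∀ y ∈ Prod.snd '' C, a • y ∈ Prod.snd '' C) :
    dimH C ≤
      dimH ((fun p : AddCircle (1 : ℝ) × AddCircle (1 : ℝ) => p.1 + p.2) '' C)
        + dimH (Prod.snd '' C) := by
  refine le_trans ?_ (dimH_prod_le_of_isClosed_of_forall_nsmul_mem ha _ hcl hinv)
  have hlip := (LipschitzWith.prod_fst (α := AddCircle (1 : ℝ)) (β := AddCircle (1 : ℝ))).sub
    LipschitzWith.prod_snd |>.prodMk LipschitzWith.prod_snd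
  refine (dimH_mono fun p hp => ?_).trans (hlip.dimH_image_le _)
  exact ⟨(p.1 + p.2, p.2), ⟨mem_image_of_mem _ hp, p, hp, rfl⟩, by simp⟩
end
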